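/- Let k ≥ 2 be even and n ≥ 1. Then for every real number q, Σ_{(σ_1,…,σ_k) ∈ S_n^k} q^{C(σ_1⋯σ_k·σ_1⁻¹⋯σ_k⁻¹)} = n! · Σ_{λ ⊢ n} H_λ^{k−2} · Π_{(i,j) ∈ λ} (q + j − i), where the sum is over partitions λ of n, H_λ is the product of the hook lengths of all cells of λ, and the product is over cells (i,j) of the Young diagram of λ (with content j − i). -/

import Mathlib

/-- Number of cycles of a permutation of `Fin n`, counting fixed points as 1-cycles. -/
def numCycles {n : ℕ} (π : Equiv.Perm (Fin n)) : ℕ :=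
  Multiset.card π.cycleType + (Finset.univ.filter fun i => π i = i).card

/-- `w_c(σ_1, …, σ_k) = σ_1 ⋯ σ_k · σ_1⁻¹ ⋯ σ_k⁻¹`. -/
def wc {n k : ℕ} (v : Fin k → Equiv.Perm (Fin n)) : Equiv.Perm (Fin n) :=
  (List.ofFn v).prod * (List.ofFn fun i => (v i)⁻¹).prod

/-- For a partition `lam` of `n` with parts sorted in decreasing order, the product
over the cells `(a,b)` (`0`-indexed) of the Young diagram of `q + content(a,b)`,
where the content of cell `(a,b)` is `b - a`. -/
noncomputable def contentProd (q : ℝ) {n : ℕ} (lam : Nat.Partition n) : ℝ :=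
  let L := lam.parts.sort (· ≥ ·)
  ∏ a ∈ Finset.range L.length, ∏ b ∈ Finset.range (L.getD a 0),
    (q + (b : ℝ) - (a : ℝ))

/-- The product `H_λ` of the hook lengths of all cells of the partition `lam`:
the hook length of the `0`-indexed cell `(a,b)` is `λ_a - b + λ'_b - a - 1`
(with `1`-indexed conventions this is `λ_i - j + λ'_j - i + 1`). -/
def hookProd {n : ℕ} (lam : Nat.Partition n) : ℕ :=
  let L := lam.parts.sort (· ≥ ·)
  ∏ a ∈ Finset.range L.length, ∏ b ∈ Finset.range (L.getD a 0),
    (L.getD a 0 + ((Finset.range L.length).filter fun a' => b < L.getD a' 0).card - a - b - 1)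

section
open Finset Polynomial

namespace WC

noncomputable def wt {ι : Type*} [DecidableEq ι] (l : ι → ℝ) (s : Finset ι) (i : ι) : ℝ :=
  ∏ j ∈ s.erase i, (1 - 1 / (l i - l j))

lemma pf_remove {ι : Type*} [DecidableEq ι] (s : Finset ι) (l : ι → ℝ) (hl : Set.InjOn l s) :
    (∀ z, (∀ i ∈ s, z ≠ l i) → ∏ j ∈ s, (1 - 1 / (z - l j)) =
      1 - ∑ i ∈ s, wt l s i / (z - l i)) ∧
    ∑ i ∈ s, wt l s i = #s ∧
    ∑ i ∈ s, l i * wt l s i =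
      ∑ i ∈ s, l i - (#s : ℝ) * (#s - 1) / 2 := by
  induction s using Finset.induction_on with
  | empty => simp
  | insert x s hx ih =>
    obtain ⟨h1, h2, h3⟩ := ih (hl.mono (by simp))
    have hxl : ∀ i ∈ s, l x ≠ l i := by
      intro i hi h
      have := hl (by simp) (by simp [hi]) h
      exact hx (this ▸ hi)
    have hax : wt l (insert x s) x =
      1 - ∑ i ∈ s, wt l s i / (l x - l i) := by
      rw [wt, erase_insert hx, h1 _ hxl]
    have hai : ∀ i ∈ s, wt l (insert x s) i =
        (1 - 1 / (l i - l x)) * wt l s i := by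
      intro i hi
      have hne : x ≠ i := fun h => hx (h ▸ hi)
      rw [wt, wt, erase_insert_of_ne hne, prod_insert (by simp [hx])]
    refine ⟨?_, ?_, ?_⟩
    · intro z hz
      have hzx : z - l x ≠ 0 := sub_ne_zero.mpr (hz x (by simp))
      rw [prod_insert hx, sum_insert hx, hax, h1 z (fun i hi => hz i (by simp [hi]))]
      have : ∀ i ∈ s, wt l (insert x s) i / (z - l i) =
          wt l s i / (z - l i) - (1 / (z - l x)) * (wt l s i / (z - l i)) + (1 / (z - l x)) * (wt l s i / (l x - l i)) := by
        intro i hi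
        have h1 : l x - l i ≠ 0 := sub_ne_zero.mpr (hxl i hi)
        have h2 : l i - l x ≠ 0 := sub_ne_zero.mpr (hxl i hi).symm
        have h3 : z - l i ≠ 0 := sub_ne_zero.mpr (hz i (by simp [hi]))
        have h4 : l i - l x = -(l x - l i) := by ring
        rw [hai i hi, h4]
        field_simp
        ring
      rw [sum_congr rfl this, sum_add_distrib, sum_sub_distrib, ← mul_sum, ← mul_sum]
      ring
    · rw [sum_insert hx, hax]
      have : ∀ i ∈ s, wt l (insert x s) i = wt l s i + wt l s i / (l x - l i) := by
        intro i hi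
        have h4 : l i - l x = -(l x - l i) := by ring
        rw [hai i hi, h4, div_neg]
        ring
      rw [sum_congr rfl this, sum_add_distrib, h2, card_insert_of_notMem hx]
      push_cast
      ring
    · rw [sum_insert hx, hax, sum_insert hx]
      have : ∀ i ∈ s, l i * wt l (insert x s) i = l i * wt l s i - wt l s i + l x * (wt l s i / (l x - l i)) := by
        intro i hi
        have h1 : l x - l i ≠ 0 := sub_ne_zero.mpr (hxl i hi)
        have h4 : l i - l x = -(l x - l i) := by ring
        rw [hai i hi, h4, div_neg]
        field_simp
        ring
      rw [sum_congr rfl this, sum_add_distrib, sum_sub_distrib, h2, h3, card_insert_of_notMem hx, ← mul_sum]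
      push_cast
      ring

lemma pf_add {ι : Type*} [Fintype ι] [DecidableEq ι] (y : ι → ℝ) (hy : Function.Injective y)
    (k : ι) (hk : ∀ i, y i + 1 - y k ≠ 0) (z : ℝ) (hz : ∀ i, z ≠ y i) (hzk : z + 1 - y k ≠ 0) :
    ∑ i, (∏ j ∈ univ.erase i, (y i + 1 - y j) / (y i - y j)) / (y i + 1 - y k) / (z - y i) =
      (∏ j, (z + 1 - y j) / (z - y j)) / (z + 1 - y k) := by
  set f : ℝ[X] := ∏ j ∈ univ.erase k, (X + C (1 - y j)) with hf
  have hdeg : f.degree < #(univ : Finset ι) := by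
    rw [hf, degree_prod]
    simp only [degree_X_add_C, sum_const]
    rw [card_erase_of_mem (mem_univ _)]
    have : 0 < #(univ : Finset ι) := card_pos.mpr ⟨k, mem_univ _⟩
    simp only [nsmul_eq_mul, mul_one]
    exact_mod_cast Nat.sub_lt this one_pos
  have hev : ∀ t, f.eval t * (t + 1 - y k) = ∏ j, (t + 1 - y j) := by
    intro t
    rw [hf, eval_prod, ← mul_prod_erase univ _ (mem_univ k), mul_comm]
    congr 1
    apply prod_congr rfl
    intros; simp; ring
  have hi := Lagrange.eq_interpolate (s := univ) (v := y) (f := f) hy.injOn hdeg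
  have h2 := congrArg (eval z) hi
  rw [Lagrange.eval_interpolate_not_at_node _ (fun i _ => hz i), Lagrange.eval_nodal] at h2
  rw [prod_div_distrib, ← hev z, mul_div_right_comm, mul_div_assoc, div_self hzk, mul_one, h2,
    mul_comm, mul_div_assoc, div_self (prod_ne_zero_iff.mpr fun i _ => sub_ne_zero.mpr (hz i)), mul_one]
  apply sum_congr rfl
  intro i _
  have h3 : eval (y i) f = (∏ j ∈ univ.erase i, (y i + 1 - y j)) / (y i + 1 - y k) := by
    rw [eq_div_iff (hk i), hev, ← mul_prod_erase univ _ (mem_univ i)]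
    simp
  rw [h3, Lagrange.nodalWeight, prod_div_distrib, prod_inv_distrib]
  field_simp

/-- uniqueness of partial fractions -/
lemma pf_unique (S : Finset ℝ) (b : ℝ → ℝ) (B : ℝ)
    (h : ∀ z, B < z → ∑ a ∈ S, b a / (z - a) = 0) : ∀ a ∈ S, b a = 0 := by
  have hp : (∑ a ∈ S, C (b a) * ∏ c ∈ S.erase a, (X - C c) : ℝ[X]) = 0 := by
    apply Polynomial.eq_zero_of_infinite_isRoot
    apply Set.Infinite.mono (s := Set.Ioi B \ (S : Set ℝ))
    · intro z hz
      simp only [Set.mem_ofPred_eq, IsRoot.def, eval_finsetSum, eval_mul, eval_C, eval_prod, eval_sub, eval_X]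
      have h1 := h z hz.1
      have : ∀ a ∈ S, b a * ∏ c ∈ S.erase a, (z - c) = (∏ c ∈ S, (z - c)) * (b a / (z - a)) := by
        intro a ha
        have : z - a ≠ 0 := sub_ne_zero.mpr (fun h => hz.2 (h ▸ ha))
        rw [← mul_prod_erase S _ ha]
        field_simp
      rw [sum_congr rfl this, ← mul_sum, h1, mul_zero]
    · exact (Set.Ioi_infinite B).sdiff (Finset.finite_toSet _)
  intro a ha
  have := congrArg (eval a) hp
  simp only [eval_finsetSum, eval_mul, eval_C, eval_prod, eval_sub, eval_X, eval_zero] at this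
  rw [sum_eq_single a] at this
  · rcases mul_eq_zero.mp this with h | h
    · exact h
    · exfalso
      rw [prod_eq_zero_iff] at h
      obtain ⟨c, hc, hc'⟩ := h
      simp at hc
      exact hc.1 (sub_eq_zero.mp hc').symm
  · intro c hc hca
    rw [prod_eq_zero (i := a), mul_zero]
    · simp [ha, Ne.symm hca]
    · simp
  · simp [ha]

end WC

end

section
open Finset Polynomial

namespace WC

def yy {N : ℕ} (f : Fin N → ℕ) (i : Fin N) : ℝ := (f i : ℝ) - (i : ℕ)
def ll {N : ℕ} (f : Fin N → ℕ) (i : Fin N) : ℕ := f i + (N - 1 - i)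
noncomputable def VV {N : ℕ} (y : Fin N → ℝ) : ℝ := ∏ a, ∏ b, if a < b then y a - y b else 1
noncomputable def DD {N : ℕ} (f : Fin N → ℕ) : ℝ := VV (yy f) / ∏ i, ((ll f i).factorial : ℝ)
noncomputable def cp {N : ℕ} (f : Fin N → ℕ) (q : ℝ) : ℝ :=
  ∏ i : Fin N, ∏ b ∈ range (f i), (q + (b : ℝ) - ((i : ℕ) : ℝ))
def Sh (N r : ℕ) : Finset (Fin N → ℕ) := by
  classical exact (piAntidiag univ r).filter Antitone
def ad {N : ℕ} (f : Fin N → ℕ) (i : Fin N) : Fin N → ℕ := Function.update f i (f i + 1)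

lemma mem_Sh {N r : ℕ} (f : Fin N → ℕ) : f ∈ Sh N r ↔ Antitone f ∧ ∑ i, f i = r := by
  simp [Sh, mem_piAntidiag, and_comm]

lemma yy_lt {N : ℕ} {f : Fin N → ℕ} (hf : Antitone f) {a b : Fin N} (h : a < b) :
    yy f b + 1 ≤ yy f a := by
  have h1 := hf h.le
  have h2 : (a : ℕ) + 1 ≤ b := h
  have h1' : (f b : ℝ) ≤ f a := by exact_mod_cast h1
  have h2' : ((a : ℕ) : ℝ) + 1 ≤ (b : ℕ) := by exact_mod_cast h2
  unfold yy; linarith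

lemma yy_inj {N : ℕ} {f : Fin N → ℕ} (hf : Antitone f) : Function.Injective (yy f) := by
  intro a b h
  rcases lt_trichotomy a b with h1 | h1 | h1
  · have := yy_lt hf h1; linarith
  · exact h1
  · have := yy_lt hf h1; linarith

lemma ll_eq {N : ℕ} (f : Fin N → ℕ) (i : Fin N) : (ll f i : ℝ) = yy f i + (N - 1) := by
  unfold ll yy
  have : (i : ℕ) + 1 ≤ N := i.2
  rw [Nat.cast_add, Nat.sub_sub, add_comm 1, Nat.cast_sub this]
  push_cast; ring

lemma yy_ad {N : ℕ} (f : Fin N → ℕ) (i : Fin N) :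
    yy (ad f i) = Function.update (yy f) i (yy f i + 1) := by
  funext j
  by_cases h : j = i
  · subst h; simp [yy, ad]; ring
  · simp [yy, ad, h]

lemma sum_ad {N : ℕ} (f : Fin N → ℕ) (i : Fin N) : ∑ j, ad f i j = ∑ j, f j + 1 := by
  unfold ad
  rw [sum_update_of_mem (mem_univ i), ← add_sum_erase univ f (mem_univ i), sdiff_singleton_eq_erase]
  ring

lemma ad_inj {N : ℕ} {f g : Fin N → ℕ} {i : Fin N} (h : ad f i = ad g i) : f = g := by
  funext j
  have := congrFun h j
  unfold ad at this
  by_cases hj : j = i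
  · subst hj; simpa using this
  · simpa [hj] using this

lemma cp_ad {N : ℕ} (f : Fin N → ℕ) (i : Fin N) (q : ℝ) :
    cp (ad f i) q = cp f q * (q + yy f i) := by
  unfold cp
  rw [← mul_prod_erase univ _ (mem_univ i), ← mul_prod_erase univ (fun i : Fin N => ∏ b ∈ range (f i), (q + (b : ℝ) - ((i : ℕ) : ℝ))) (mem_univ i)]
  have : ∏ x ∈ univ.erase i, ∏ b ∈ range (ad f i x), (q + (b : ℝ) - ((x : ℕ) : ℝ)) =
    ∏ x ∈ univ.erase i, ∏ b ∈ range (f x), (q + (b : ℝ) - ((x : ℕ) : ℝ)) := by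
    apply prod_congr rfl
    intro x hx
    rw [ad, Function.update_of_ne (ne_of_mem_erase hx)]
  rw [this]
  simp only [ad, Function.update_self, prod_range_succ, yy]
  ring

lemma VV_update {N : ℕ} (y : Fin N → ℝ) (i : Fin N) :
    ∃ c, ∀ t, VV (Function.update y i t) = c * ∏ j ∈ univ.erase i, (t - y j) := by
  refine ⟨(∏ a ∈ univ.erase i, ∏ b ∈ univ.erase i, if a < b then y a - y b else 1) *
    ∏ j ∈ univ.erase i, (if j < i then -1 else 1), fun t => ?_⟩
  unfold VV
  rw [← mul_prod_erase univ _ (mem_univ i), ← mul_prod_erase univ _ (mem_univ i)]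
  have h1 : ∀ a ∈ univ.erase i, (∏ b, if a < b then Function.update y i t a - Function.update y i t b else 1) =
     (if a < i then y a - t else 1) * ∏ b ∈ univ.erase i, if a < b then y a - y b else 1 := by
    intro a ha
    rw [← mul_prod_erase univ _ (mem_univ i)]
    rw [Function.update_of_ne (ne_of_mem_erase ha), Function.update_self]
    congr 1
    apply prod_congr rfl
    intro b hb
    rw [Function.update_of_ne (ne_of_mem_erase hb)]
  rw [prod_congr rfl h1, prod_mul_distrib]
  have h2 : ∀ b ∈ univ.erase i, (if i < b then Function.update y i t i - Function.update y i t b else 1) =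
     (if i < b then t - y b else 1) := by
    intro b hb
    rw [Function.update_of_ne (ne_of_mem_erase hb), Function.update_self]
  rw [prod_congr rfl h2]
  have h3 : ∀ b ∈ univ.erase i, (t - y b) = (if i < b then t - y b else 1) * (if b < i then y b - t else 1) * (if b < i then -1 else 1) := by
    intro b hb
    have hne := ne_of_mem_erase hb
    rcases lt_or_gt_of_ne hne with h | h
    · simp [h, h.not_gt]
    · simp [h, h.not_gt]
  have h4 : (∏ b ∈ univ.erase i, (if b < i then (-1 : ℝ) else 1)) * (∏ b ∈ univ.erase i, (if b < i then (-1 : ℝ) else 1)) = 1 := by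
    rw [← prod_mul_distrib]
    apply prod_eq_one
    intro b _
    split_ifs <;> simp
  rw [prod_congr rfl h3, prod_mul_distrib, prod_mul_distrib]
  simp only [lt_irrefl, if_false, one_mul]
  linear_combination (-(∏ b ∈ univ.erase i, if i < b then t - y b else 1) * (∏ b ∈ univ.erase i, if b < i then y b - t else 1) *
    (∏ a ∈ univ.erase i, ∏ b ∈ univ.erase i, if a < b then y a - y b else 1)) * h4

lemma DD_ad {N : ℕ} {f : Fin N → ℕ} (hf : Antitone f) (i : Fin N) :
    DD (ad f i) = DD f * (∏ j ∈ univ.erase i, (yy f i + 1 - yy f j) / (yy f i - yy f j)) / (yy f i + N) := by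
  obtain ⟨c, hc⟩ := VV_update (yy f) i
  unfold DD
  have h0 : VV (yy f) = c * ∏ j ∈ univ.erase i, (yy f i - yy f j) := by
    rw [← hc, Function.update_eq_self]
  have h1 : ∏ j, ((ll (ad f i) j).factorial : ℝ) = (∏ j, ((ll f j).factorial : ℝ)) * (yy f i + N) := by
    rw [← mul_prod_erase univ _ (mem_univ i), ← mul_prod_erase univ (fun j => ((ll f j).factorial : ℝ)) (mem_univ i)]
    have h2 : ll (ad f i) i = ll f i + 1 := by
      unfold ll ad; simp; ring
    have h3 : ∀ j ∈ univ.erase i, ((ll (ad f i) j).factorial : ℝ) = (ll f j).factorial := by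
      intro j hj
      unfold ll ad
      rw [Function.update_of_ne (ne_of_mem_erase hj)]
    rw [h2, prod_congr rfl h3, Nat.factorial_succ]
    push_cast
    rw [ll_eq]; ring
  have hne : ∏ j ∈ univ.erase i, (yy f i - yy f j) ≠ 0 := by
    rw [prod_ne_zero_iff]
    intro j hj
    exact sub_ne_zero.mpr (fun h => ne_of_mem_erase hj (yy_inj hf h).symm)
  rw [yy_ad, hc, h0, h1, prod_div_distrib]
  field_simp

lemma row_id (k : ℕ) (i z : ℝ) :
    (∏ b ∈ range k, (-z + (b : ℝ) - i)) ^ 2 * ((z - (k - i)) * (z + 1 + i)) =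
    ((z + i) * (z + 1 - (k - i))) * ((∏ b ∈ range k, (1 - z + (b : ℝ) - i)) * ∏ b ∈ range k, (-1 - z + (b : ℝ) - i)) := by
  induction k with
  | zero => simp
  | succ k ih =>
    simp only [prod_range_succ]
    push_cast
    linear_combination ((z - k + i) * (z - k + i - 1)) * ih

lemma tele (N : ℕ) (z : ℝ) : (∏ i : Fin N, (z + ((i : ℕ) : ℝ))) * (z + N) = z * ∏ i : Fin N, (z + 1 + ((i : ℕ) : ℝ)) := by
  rw [Fin.prod_univ_eq_prod_range (fun i => z + (i : ℝ)), Fin.prod_univ_eq_prod_range (fun i => z + 1 + (i : ℝ)),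
    ← prod_range_succ (fun i : ℕ => z + (i : ℝ)), prod_range_succ', mul_comm]
  simp only [Nat.cast_zero, add_zero]
  congr 1
  apply prod_congr rfl
  intros; push_cast; ring

lemma cp_id {N : ℕ} (f : Fin N → ℕ) (z : ℝ) :
    cp f (-z) ^ 2 * ((∏ i, (z - yy f i)) * (z + N)) * (∏ i : Fin N, (z + 1 + ((i : ℕ) : ℝ))) =
      z * (∏ i : Fin N, (z + 1 + ((i : ℕ) : ℝ))) * (∏ i, (z + 1 - yy f i)) * (cp f (1 - z) * cp f (-1 - z)) := by
  rw [← tele]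
  have := prod_congr (rfl : (univ : Finset (Fin N)) = univ) (fun i _ => row_id (f i) ((i : ℕ) : ℝ) z)
  simp only [prod_mul_distrib, prod_pow] at this
  unfold cp yy
  linear_combination (z + N) * this

lemma cp_ne {N : ℕ} {r : ℕ} {f : Fin N → ℕ} (hf : f ∈ Sh N r) (z : ℝ) (hz : (r : ℝ) ≤ z) : cp f (-z) ≠ 0 := by
  rw [mem_Sh] at hf
  unfold cp
  rw [prod_ne_zero_iff]; intro i _
  rw [prod_ne_zero_iff]; intro b hb
  rw [mem_range] at hb
  have h1 : f i ≤ r := by rw [← hf.2]; exact single_le_sum (fun _ _ => Nat.zero_le _) (mem_univ i)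
  have h2 : (b : ℝ) + 1 ≤ r := by exact_mod_cast hb.trans_le h1
  have h3 : (0 : ℝ) ≤ (i : ℕ) := by positivity
  intro h; linarith

lemma last_zero {N r : ℕ} (hr : r < N) {f : Fin N → ℕ} (hf : f ∈ Sh N r) : f ⟨N - 1, by omega⟩ = 0 := by
  rw [mem_Sh] at hf
  by_contra h
  have : ∑ i : Fin N, 1 ≤ ∑ i, f i := by
    apply sum_le_sum
    intro i _
    have := hf.1 (show i ≤ ⟨N - 1, by omega⟩ from by rw [Fin.le_def]; have := i.2; simp; omega)
    omega
  simp at this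
  omega

lemma G_id {N r : ℕ} (hr : r < N) {f : Fin N → ℕ} (hf : f ∈ Sh N r) (z : ℝ) (hz : (N + 1 : ℝ) < z) :
    z * (cp f (1 - z) * cp f (-1 - z)) * ∑ i, DD (ad f i) / (z - yy f i) = DD f * cp f (-z) ^ 2 := by
  have hf' := (mem_Sh f).1 hf
  have hl := last_zero hr hf
  have hr' : (r : ℝ) + 1 ≤ N := by exact_mod_cast hr
  have hylt : ∀ i, yy f i < z := by
    intro i
    have h1 : f i ≤ r := by rw [← hf'.2]; exact single_le_sum (fun _ _ => Nat.zero_le _) (mem_univ i)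
    have h2 : (f i : ℝ) ≤ r := by exact_mod_cast h1
    have h3 : (0 : ℝ) ≤ (i : ℕ) := by positivity
    unfold yy; linarith
  have hyl : yy f ⟨N - 1, by omega⟩ = 1 - N := by
    unfold yy; rw [hl]; simp only
    rw [Nat.cast_sub (by omega)]; push_cast; ring
  have hygt : ∀ i, 1 - (N : ℝ) ≤ yy f i := by
    intro i
    have h3 : ((i : ℕ) : ℝ) + 1 ≤ N := by exact_mod_cast i.2
    have h4 : (0 : ℝ) ≤ f i := by positivity
    unfold yy; linarith
  have key := pf_add (yy f) (yy_inj hf'.1) ⟨N - 1, by omega⟩ (by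
    intro i; have := hygt i; rw [hyl]; intro h; linarith) z (fun i => (hylt i).ne') (by
    rw [hyl]; intro h; linarith [(Nat.cast_nonneg N : (0:ℝ) ≤ N)])
  rw [hyl] at key
  have hsum : ∑ i, DD (ad f i) / (z - yy f i) = DD f * ((∏ j, (z + 1 - yy f j) / (z - yy f j)) / (z + 1 - (1 - N))) := by
    rw [← key, mul_sum]
    apply sum_congr rfl
    intro i _
    rw [DD_ad hf'.1]
    have : yy f i + 1 - (1 - (N : ℝ)) = yy f i + N := by ring
    rw [this]; ring
  rw [hsum, prod_div_distrib]
  have hid := cp_id f z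
  have h1 : ∏ i : Fin N, (z + 1 + ((i : ℕ) : ℝ)) ≠ 0 := by
    rw [prod_ne_zero_iff]; intro i _
    have : (0 : ℝ) ≤ (i : ℕ) := by positivity
    intro h; linarith [(Nat.cast_nonneg N : (0:ℝ) ≤ N)]
  have h2 : ∏ i, (z - yy f i) ≠ 0 := by
    rw [prod_ne_zero_iff]; intro i _
    exact sub_ne_zero.mpr (hylt i).ne'
  have h3 : z + N ≠ 0 := by intro h; linarith [(Nat.cast_nonneg N : (0:ℝ) ≤ N)]
  have h4 : z + 1 - (1 - (N : ℝ)) = z + N := by ring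
  have hid' : cp f (-z) ^ 2 * ((∏ i, (z - yy f i)) * (z + N)) = z * (∏ i, (z + 1 - yy f i)) * (cp f (1 - z) * cp f (-1 - z)) := by
    apply mul_right_cancel₀ h1
    linear_combination hid
  rw [h4]
  field_simp
  linear_combination -DD f * hid'

lemma DD_zero {N r : ℕ} {f : Fin N → ℕ} (hf : f ∈ Sh N r) (i : Fin N) (h : ad f i ∉ Sh N (r + 1)) : DD (ad f i) = 0 := by
  rw [mem_Sh] at hf
  have h1 : ¬ Antitone (ad f i) := by
    intro h'; exact h ((mem_Sh _).2 ⟨h', by rw [sum_ad, hf.2]⟩)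
  have h2 : ∃ a, a < i ∧ f a = f i := by
    unfold Antitone at h1
    push Not at h1
    obtain ⟨a, b, hab, hlt⟩ := h1
    have hfab := hf.1 hab
    unfold ad at hlt
    have hb : b = i := by
      by_contra hb
      rw [Function.update_of_ne hb] at hlt
      by_cases ha : a = i
      · subst ha; simp at hlt; omega
      · rw [Function.update_of_ne ha] at hlt; omega
    subst hb
    have ha : a ≠ b := by rintro rfl; simp at hlt
    rw [Function.update_of_ne ha, Function.update_self] at hlt
    exact ⟨a, lt_of_le_of_ne hab ha, by omega⟩
  obtain ⟨a, hai, hfa⟩ := h2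
  have hi : 0 < (i : ℕ) := by have : (a : ℕ) < i := hai; omega
  set b : Fin N := ⟨i - 1, by omega⟩ with hb
  have hbi : b < i := by rw [Fin.lt_def]; simp [hb]; omega
  have hfb : f b = f i := by
    have h1 := hf.1 (show a ≤ b by rw [Fin.le_def]; have : (a : ℕ) < i := hai; simp [hb]; omega)
    have h2 := hf.1 hbi.le
    omega
  unfold DD VV
  rw [prod_eq_zero (mem_univ b), zero_div]
  rw [prod_eq_zero (mem_univ i)]
  rw [if_pos hbi, yy_ad, Function.update_of_ne hbi.ne, Function.update_self]
  unfold yy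
  rw [hfb]
  simp only [hb]
  rw [Nat.cast_sub (by omega)]; push_cast; ring

end WC

end

section
open Finset Polynomial

namespace WC

lemma rem_one {N r : ℕ} {L : Fin N → ℕ} (hL : L ∈ Sh N (r + 1)) (i : Fin N) :
    ∑ v ∈ Sh N r, (if ad v i = L then DD v else 0) =
      DD L * ((ll L i : ℝ) * wt (fun j => (ll L j : ℝ)) univ i) := by
  have hL' := (mem_Sh L).1 hL
  by_cases hex : ∃ v ∈ Sh N r, ad v i = L
  · obtain ⟨v, hv, rfl⟩ := hex
    have hv' := (mem_Sh v).1 hv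
    rw [sum_eq_single v (by
      intro b _ hb; rw [if_neg]; intro h; exact hb (ad_inj h)) (fun h => (h hv).elim), if_pos rfl]
    have h1 : ∀ j, j ≠ i → yy (ad v i) j = yy v j := by
      intro j hj; rw [yy_ad, Function.update_of_ne hj]
    have h2 : yy (ad v i) i = yy v i + 1 := by rw [yy_ad, Function.update_self]
    have h3 : ∀ j ∈ univ.erase i, yy v i + 1 - yy v j ≠ 0 := by
      intro j hj
      rw [← h1 j (ne_of_mem_erase hj), ← h2]
      exact sub_ne_zero.mpr (fun h => ne_of_mem_erase hj (yy_inj hL'.1 h).symm)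
    have h4 : wt (fun j => (ll (ad v i) j : ℝ)) univ i =
        ∏ j ∈ univ.erase i, (yy v i - yy v j) / (yy v i + 1 - yy v j) := by
      unfold wt
      apply prod_congr rfl
      intro j hj
      have := h3 j hj
      simp only [ll_eq]
      rw [h1 j (ne_of_mem_erase hj), h2]
      rw [show yy v i + 1 + ((N : ℝ) - 1) - (yy v j + (N - 1)) = yy v i + 1 - yy v j by ring]
      field_simp
      ring
    have h5 : (ll (ad v i) i : ℝ) = yy v i + N := by rw [ll_eq, h2]; ring
    have h6 : yy v i + N ≠ 0 := by
      rw [← h5]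
      have : 0 < ll (ad v i) i := by unfold ll ad; simp
      positivity
    have h7 : ∏ j ∈ univ.erase i, (yy v i - yy v j) ≠ 0 := by
      rw [prod_ne_zero_iff]
      intro j hj
      exact sub_ne_zero.mpr (fun h => ne_of_mem_erase hj (yy_inj hv'.1 h).symm)
    have h8 := prod_ne_zero_iff.2 h3
    rw [DD_ad hv'.1, h4, h5, prod_div_distrib, prod_div_distrib]
    field_simp
  · push Not at hex
    rw [sum_eq_zero (fun v hv => if_neg (hex v hv))]
    by_cases hj : ∃ j : Fin N, (j : ℕ) = i + 1 ∧ L j = L i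
    · obtain ⟨j, hj, hLj⟩ := hj
      unfold wt
      rw [prod_eq_zero (i := j)]
      · ring
      · rw [mem_erase]; refine ⟨?_, mem_univ _⟩; rintro rfl; omega
      · simp only [ll_eq]
        unfold yy
        rw [hLj, hj]; push_cast; norm_num
    · push Not at hj
      have hLi : L i = 0 := by
        by_contra h0
        apply hex (Function.update L i (L i - 1))
        · rw [mem_Sh]
          constructor
          · intro a b hab
            have hLab := hL'.1 hab
            by_cases hb : b = i
            · subst hb
              rw [Function.update_self]
              by_cases ha : a = b
              · subst ha; simp
              · rw [Function.update_of_ne ha]; omega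
            · rw [Function.update_of_ne hb]
              by_cases ha : a = i
              · subst ha
                rw [Function.update_self]
                have hlt : (a : ℕ) < b := lt_of_le_of_ne hab (fun h => hb (Fin.ext h.symm))
                have h1 := hj ⟨a + 1, by omega⟩ rfl
                have h2 := hL'.1 (show a ≤ ⟨a + 1, by omega⟩ by rw [Fin.le_def]; simp)
                have h3 := hL'.1 (show (⟨a + 1, by omega⟩ : Fin N) ≤ b by rw [Fin.le_def]; simp; omega)
                omega
              · rw [Function.update_of_ne ha]; exact hLab
          · have := hL'.2
            rw [← add_sum_erase univ L (mem_univ i)] at this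
            rw [sum_update_of_mem (mem_univ i), sdiff_singleton_eq_erase]
            omega
        · unfold ad
          rw [Function.update_idem, Function.update_self, Nat.sub_add_cancel (by omega), Function.update_eq_self]
      have hi : ¬ ((i : ℕ) + 1 < N) := by
        intro h
        have h1 := hj ⟨i + 1, h⟩ rfl
        have h2 := hL'.1 (show i ≤ ⟨i + 1, h⟩ by rw [Fin.le_def]; simp)
        omega
      have : ll L i = 0 := by unfold ll; omega
      rw [this]; simp

lemma ll_inj {N : ℕ} {f : Fin N → ℕ} (hf : Antitone f) : Function.Injective (ll f) := by
  intro a b h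
  apply yy_inj hf
  have : (ll f a : ℝ) = ll f b := by rw [h]
  rw [ll_eq, ll_eq] at this; linarith

lemma rem_sum {N r : ℕ} {L : Fin N → ℕ} (hL : L ∈ Sh N (r + 1)) :
    ∑ v ∈ Sh N r, ∑ i, (if ad v i = L then DD v else 0) = (r + 1) * DD L := by
  have hL' := (mem_Sh L).1 hL
  rw [sum_comm, sum_congr rfl (fun i _ => rem_one hL i), ← mul_sum]
  have h1 := (pf_remove univ (fun j => (ll L j : ℝ)) (by
    intro a _ b _ h; exact ll_inj hL'.1 (by simpa using h))).2.2
  rw [h1]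
  have h2 : ∑ i : Fin N, (ll L i : ℝ) = (r + 1) + (N : ℝ) * (N - 1) / 2 := by
    simp only [ll_eq]
    unfold yy
    rw [sum_add_distrib, sum_sub_distrib]
    have h3 : ∑ i, (L i : ℝ) = r + 1 := by exact_mod_cast hL'.2
    have h4 : ∑ i : Fin N, ((i : ℕ) : ℝ) = (N : ℝ) * (N - 1) / 2 := by
      rw [Fin.sum_univ_eq_sum_range (fun i => (i : ℝ))]
      clear * -
      induction N with
      | zero => simp
      | succ n ih => rw [sum_range_succ, ih]; push_cast; ring
    rw [h3, h4]; simp; ring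
  rw [h2]; simp; ring

/-- conjugate -/
def cj {N : ℕ} (f : Fin N → ℕ) (b : ℕ) : ℕ := (univ.filter fun a => b < f a).card

def hk {N : ℕ} (f : Fin N → ℕ) : ℕ := ∏ a : Fin N, ∏ b ∈ range (f a), (f a + cj f b - a - b - 1)

lemma cj_gt {N : ℕ} {f : Fin N → ℕ} (hf : Antitone f) {b : ℕ} {a : Fin N} (h : b < f a) : (a : ℕ) < cj f b := by
  have : (univ.filter fun c : Fin N => c ≤ a) ⊆ univ.filter fun c => b < f c := by
    intro c hc
    simp only [mem_filter, mem_univ, true_and] at *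
    exact h.trans_le (hf hc)
  have := card_le_card this
  have h2 : (univ.filter fun c : Fin N => c ≤ a).card = a + 1 := by
    rw [show (univ.filter fun c : Fin N => c ≤ a) = Iic a by ext; simp]
    simp
  unfold cj; omega

lemma cj_le {N : ℕ} {f : Fin N → ℕ} (hf : Antitone f) {b : ℕ} {a : Fin N} (h : f a ≤ b) : cj f b ≤ a := by
  have : (univ.filter fun c => b < f c) ⊆ (univ.filter fun c : Fin N => c < a) := by
    intro c hc
    simp only [mem_filter, mem_univ, true_and] at *
    by_contra h'
    have := hf (not_lt.1 h'); omega
  have := card_le_card this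
  have h2 : (univ.filter fun c : Fin N => c < a).card = a := by
    rw [show (univ.filter fun c : Fin N => c < a) = Iio a by ext; simp]
    simp
  unfold cj; omega

lemma cj_leN {N : ℕ} (f : Fin N → ℕ) (b : ℕ) : cj f b ≤ N := by
  unfold cj
  exact (card_filter_le _ _).trans (by simp)

lemma cj_anti {N : ℕ} (f : Fin N → ℕ) {b c : ℕ} (h : b ≤ c) : cj f c ≤ cj f b := by
  apply card_le_card
  intro a ha
  simp only [mem_filter, mem_univ, true_and] at *
  omega

lemma row_hook {N : ℕ} {f : Fin N → ℕ} (hf : Antitone f) (a : Fin N) :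
    (∏ b ∈ range (f a), (f a + cj f b - a - b - 1)) * ∏ j ∈ Ioi a, (ll f a - ll f j) = (ll f a).factorial := by
  have hg : Set.InjOn (fun b => N + b - cj f b) (range (f a)) := by
    intro b _ c _ h
    simp only at h
    have := cj_leN f b
    have := cj_leN f c
    rcases lt_trichotomy b c with h1 | h1 | h1
    · have := cj_anti f h1.le; omega
    · exact h1
    · have := cj_anti f h1.le; omega
  have hlt : ∀ j ∈ Ioi a, ll f j < ll f a := by
    intro j hj
    rw [mem_Ioi] at hj
    have := hf hj.le
    have hj' : (a : ℕ) < j := hj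
    unfold ll
    have := j.2
    omega
  have hdis : Disjoint ((range (f a)).image (fun b => N + b - cj f b)) ((Ioi a).image (ll f)) := by
    rw [disjoint_left]
    intro x hx hx'
    rw [mem_image] at hx hx'
    obtain ⟨b, hb, rfl⟩ := hx
    obtain ⟨j, hj, hj'⟩ := hx'
    have h1 := cj_leN f b
    have h2 := j.2
    unfold ll at hj'
    by_cases h : b < f j
    · have := cj_gt hf h; omega
    · have := cj_le hf (not_lt.1 h); omega
  have hun : range (ll f a) = ((range (f a)).image (fun b => N + b - cj f b)).disjUnion ((Ioi a).image (ll f)) hdis := by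
    symm
    apply eq_of_subset_of_card_le
    · rw [disjUnion_eq_union]
      apply union_subset
      · intro x hx
        rw [mem_image] at hx
        obtain ⟨b, hb, rfl⟩ := hx
        rw [mem_range] at *
        have := cj_gt hf hb
        have := cj_leN f b
        unfold ll; omega
      · intro x hx
        rw [mem_image] at hx
        obtain ⟨j, hj, rfl⟩ := hx
        rw [mem_range]; exact hlt j hj
    · rw [card_disjUnion, card_image_of_injOn hg, card_image_of_injective _ (ll_inj hf)]
      simp [ll]
  have hfac : (ll f a).factorial = ∏ x ∈ range (ll f a), (ll f a - x) := by
    rw [← prod_range_add_one_eq_factorial, ← prod_range_reflect]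
    apply prod_congr rfl
    intro x hx
    rw [mem_range] at hx; omega
  rw [hfac, hun, prod_disjUnion, prod_image hg, prod_image (ll_inj hf).injOn]
  congr 1
  apply prod_congr rfl
  intro b hb
  rw [mem_range] at hb
  have h1 := cj_gt hf hb
  have h2 := cj_leN f b
  unfold ll; omega

lemma DD_hk {N : ℕ} {f : Fin N → ℕ} (hf : Antitone f) : DD f * hk f = 1 := by
  have h1 : ∀ a, (∏ b, if a < b then yy f a - yy f b else 1) = ((∏ j ∈ Ioi a, (ll f a - ll f j) : ℕ) : ℝ) := by
    intro a
    rw [← prod_filter]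
    rw [show (univ.filter fun c : Fin N => a < c) = Ioi a by ext; simp]
    push_cast
    apply prod_congr rfl
    intro j hj
    rw [mem_Ioi] at hj
    have hj' : (a : ℕ) < j := hj
    have := hf hj.le
    rw [Nat.cast_sub (by unfold ll; omega), ll_eq, ll_eq]; ring
  unfold DD VV hk
  rw [prod_congr rfl (fun a _ => h1 a)]
  rw [div_mul_eq_mul_div, div_eq_one_iff_eq (by rw [prod_ne_zero_iff]; intros; positivity)]
  rw [Nat.cast_prod, ← prod_mul_distrib]
  apply prod_congr rfl
  intro a _
  rw [← row_hook hf a]; push_cast; ring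

lemma cp_sep {N r : ℕ} {f g : Fin N → ℕ} (hf : f ∈ Sh N r) (hg : g ∈ Sh N r) (hne : f ≠ g) :
    ∃ q, cp f q ≠ cp g q := by
  classical
  by_contra hcon
  push Not at hcon
  have hf' := (mem_Sh f).1 hf
  have hg' := (mem_Sh g).1 hg
  obtain ⟨i, hi, hmin⟩ : ∃ i, f i ≠ g i ∧ ∀ j < i, f j = g j := by
    have hn : (univ.filter fun i => f i ≠ g i).Nonempty := by
      rw [filter_nonempty_iff]
      by_contra h; push Not at h; exact hne (funext fun i => h i (mem_univ _))
    refine ⟨_, (mem_filter.1 (min'_mem _ hn)).2, fun j hj => ?_⟩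
    by_contra h
    exact absurd (min'_le _ j (mem_filter.2 ⟨mem_univ _, h⟩)) (not_le.2 hj)
  have key : ∀ f g : Fin N → ℕ, Antitone f → Antitone g → (∀ q, cp f q = cp g q) → (∀ j < i, f j = g j) → ¬ (g i < f i) := by
    clear * -
    intro f g hf hg hcon hmin hlt
    set row : (Fin N → ℕ) → Fin N → ℝ[X] := fun f a => ∏ b ∈ range (f a), (X + C ((b : ℝ) - ((a : ℕ) : ℝ))) with hrow
    have hev : ∀ f q, cp f q = (∏ a, row f a).eval q := by
      intro f q
      simp only [hrow, eval_prod, cp]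
      simp
      apply prod_congr rfl; intros; apply prod_congr rfl; intros; ring
    have hp : ∏ a, row f a = ∏ a, row g a := by
      apply Polynomial.funext
      intro q; rw [← hev, ← hev, hcon]
    have hs : ∀ f : Fin N → ℕ, ∏ a, row f a = (∏ a ∈ Iio i, row f a) * ∏ a ∈ Ici i, row f a := by
      intro f
      rw [← prod_union]
      · congr 1; ext x; simp [lt_or_ge]
      · rw [disjoint_left]; intro x; simp
    rw [hs, hs] at hp
    have h1 : ∏ a ∈ Iio i, row f a = ∏ a ∈ Iio i, row g a := by
      apply prod_congr rfl
      intro j hj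
      rw [mem_Iio] at hj
      simp only [hrow, hmin j hj]
    rw [h1] at hp
    have h2 : ∏ a ∈ Iio i, row g a ≠ 0 := by
      rw [prod_ne_zero_iff]; intro a _
      simp only [hrow]; rw [prod_ne_zero_iff]; intro b _
      exact X_add_C_ne_zero _
    have h3 := mul_left_cancel₀ h2 hp
    have h4 := congrArg (eval (-(((f i - 1 : ℕ) : ℝ) - ((i : ℕ) : ℝ)))) h3
    rw [eval_prod, eval_prod, prod_eq_zero (i := i) (by simp)] at h4
    · symm at h4
      rw [prod_eq_zero_iff] at h4
      obtain ⟨j, hj, h5⟩ := h4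
      simp only [hrow] at h5
      rw [eval_prod, prod_eq_zero_iff] at h5
      obtain ⟨b, hb, h6⟩ := h5
      rw [mem_range] at hb
      rw [mem_Ici] at hj
      have := hg hj
      have h7 : (i : ℕ) ≤ j := hj
      simp at h6
      have h8 : ((b + i : ℕ) : ℝ) = ((f i - 1 + j : ℕ) : ℝ) := by push_cast; linarith
      have h9 : b + i = f i - 1 + j := by exact_mod_cast h8
      omega
    · simp only [hrow]
      rw [eval_prod, prod_eq_zero (i := f i - 1)]
      · rw [mem_range]; omega
      · simp
  rcases lt_or_gt_of_ne hi with h | h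
  · exact key g f hg'.1 hf'.1 (fun q => (hcon q).symm) (fun j hj => (hmin j hj).symm) h
  · exact key f g hf'.1 hg'.1 hcon hmin h

lemma DD_init {N : ℕ} : DD (fun _ : Fin N => 0) = 1 := by
  have := DD_hk (f := fun _ : Fin N => 0) (fun _ _ _ => le_rfl)
  simpa [hk] using this

lemma DD_pos {N : ℕ} {f : Fin N → ℕ} (hf : Antitone f) : 0 < DD f := by
  have h := DD_hk hf
  have h2 : (0 : ℝ) ≤ hk f := by positivity
  by_contra h3
  nlinarith

lemma Sh_zero (N : ℕ) : Sh N 0 = {fun _ => 0} := by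
  ext f
  rw [mem_Sh, mem_singleton]
  constructor
  · rintro ⟨_, h⟩
    funext i
    simpa using (sum_eq_zero_iff.1 h) i (mem_univ i)
  · rintro rfl; exact ⟨fun _ _ _ => le_rfl, by simp⟩

end WC

end

section
open Finset Polynomial

namespace WC

set_option linter.unusedSectionVars false

section grp
variable {G : Type*} [Group G] [Fintype G] [DecidableEq G]

noncomputable def dl (g : G) : MonoidAlgebra ℝ G := MonoidAlgebra.single g 1

lemma dl_mul (g h : G) : dl g * dl h = dl (g * h) := by
  simp [dl, MonoidAlgebra.single_mul_single]

lemma dl_one : dl (1 : G) = 1 := rfl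

lemma A_ind {p : MonoidAlgebra ℝ G → Prop} (x : MonoidAlgebra ℝ G) (h1 : ∀ g, p (dl g))
    (h2 : ∀ x y, p x → p y → p (x + y)) (h3 : ∀ (c : ℝ) x, p x → p (c • x)) : p x := by
  induction x using MonoidAlgebra.induction_linear with
  | zero => simpa using h3 0 _ (h1 1)
  | add f g hf hg => exact h2 _ _ hf hg
  | single a b => simpa [dl] using h3 b _ (h1 a)

noncomputable def tr : MonoidAlgebra ℝ G →ₗ[ℝ] ℝ :=
  (Finsupp.lapply 1).comp (MonoidAlgebra.coeffLinearEquiv ℝ).toLinearMap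

lemma tr_apply (x : MonoidAlgebra ℝ G) : tr x = x.coeff 1 := rfl

lemma tr_dl (g : G) : tr (dl g) = if g = 1 then 1 else 0 := by
  rw [tr_apply, dl, MonoidAlgebra.coeff_single, Finsupp.single_apply]

lemma tr_comm (x y : MonoidAlgebra ℝ G) : tr (x * y) = tr (y * x) := by
  classical
  induction x using A_ind with
  | h1 g =>
    induction y using A_ind with
    | h1 h => rw [dl_mul, dl_mul, tr_dl, tr_dl]; have e : g * h = 1 ↔ h * g = 1 := mul_eq_one_comm; simp only [e]
    | h2 x y hx hy => rw [mul_add, add_mul, map_add, map_add, hx, hy]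
    | h3 c x hx => rw [mul_smul_comm, smul_mul_assoc, map_smul, map_smul, hx]
  | h2 x y hx hy => rw [mul_add, add_mul, map_add, map_add, hx, hy]
  | h3 c x hx => rw [mul_smul_comm, smul_mul_assoc, map_smul, map_smul, hx]

noncomputable def st : MonoidAlgebra ℝ G →ₗ[ℝ] MonoidAlgebra ℝ G :=
  MonoidAlgebra.mapDomainLinearMap ℝ ℝ (fun g => g⁻¹)

lemma st_dl (g : G) : st (dl g) = dl g⁻¹ := by
  rw [st, dl, MonoidAlgebra.mapDomainLinearMap_single]; rfl

lemma st_mul (x y : MonoidAlgebra ℝ G) : st (x * y) = st y * st x := by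
  induction x using A_ind with
  | h1 g =>
    induction y using A_ind with
    | h1 h => rw [dl_mul, st_dl, st_dl, st_dl, dl_mul, mul_inv_rev]
    | h2 x y hx hy => rw [mul_add, map_add, map_add, add_mul, hx, hy]
    | h3 c x hx => rw [mul_smul_comm, map_smul, map_smul, smul_mul_assoc, hx]
  | h2 x y hx hy => rw [map_add, mul_add, add_mul, map_add, hx, hy]
  | h3 c x hx => rw [smul_mul_assoc, map_smul, map_smul, mul_smul_comm,  hx]

lemma coeff_st (x : MonoidAlgebra ℝ G) (g : G) : (st x).coeff g = x.coeff g⁻¹ := by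
  classical
  induction x using A_ind with
  | h1 h => rw [st_dl, dl, dl, MonoidAlgebra.coeff_single, MonoidAlgebra.coeff_single, Finsupp.single_apply, Finsupp.single_apply]; simp [inv_eq_iff_eq_inv]
  | h2 x y hx hy => simp [hx, hy]
  | h3 c x hx => simp [hx]

lemma st_one : st (1 : MonoidAlgebra ℝ G) = 1 := by
  rw [← dl_one, st_dl, inv_one]

lemma st_pow {x : MonoidAlgebra ℝ G} (hx : st x = x) (n : ℕ) : st (x ^ n) = x ^ n := by
  induction n with
  | zero => simp [st_one]
  | succ n ih => rw [pow_succ, st_mul, hx, ih, ← pow_succ', ← pow_succ]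

lemma st_aeval {x : MonoidAlgebra ℝ G} (hx : st x = x) (p : ℝ[X]) : st (aeval x p) = aeval x p := by
  rw [aeval_eq_sum_range, map_sum]
  apply sum_congr rfl
  intro i _
  rw [map_smul, st_pow hx]

lemma coeff_mul' (x y : MonoidAlgebra ℝ G) (g : G) : (x * y).coeff g = ∑ h, x.coeff h * y.coeff (h⁻¹ * g) := by
  classical
  rw [MonoidAlgebra.coeff_mul_apply_left, Finsupp.sum_fintype]
  intro i; simp

lemma tr_sq_zero {x : MonoidAlgebra ℝ G} (hx : st x = x) (h : tr (x * x) = 0) : x = 0 := by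
  rw [tr_apply, coeff_mul'] at h
  have h1 : ∀ g, x.coeff (g⁻¹ * 1) = x.coeff g := by
    intro g
    rw [mul_one, ← coeff_st, hx]
  simp only [h1] at h
  rw [sum_eq_zero_iff_of_nonneg (fun i _ => mul_self_nonneg _)] at h
  rw [← MonoidAlgebra.coeff_eq_zero]
  ext g
  simpa using h g (mem_univ g)

/-- spectral annihilator -/
lemma spec_ann {x : MonoidAlgebra ℝ G} (hx : st x = x) :
    ∃ S : Finset ℝ, aeval x (∏ a ∈ S, (X - C a)) = 0 := by
  set b := MonoidAlgebra.basis G ℝ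
  set M := Algebra.leftMulMatrix b x with hM
  have hc : ∀ g h, M g h = x.coeff (g * h⁻¹) := by
    intro g h
    rw [hM, Algebra.leftMulMatrix_eq_repr_mul, MonoidAlgebra.basis_apply]
    change (x * MonoidAlgebra.single h 1).coeff g = _
    rw [MonoidAlgebra.coeff_mul_single_apply, mul_one]
  have hH : M.IsHermitian := by
    ext g h
    rw [Matrix.conjTranspose_apply, hc, hc, star_trivial]
    conv_lhs => rw [← hx, coeff_st, mul_inv_rev, inv_inv]
  classical
  refine ⟨univ.image hH.eigenvalues, ?_⟩
  apply Algebra.leftMulMatrix_injective b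
  rw [map_zero, ← aeval_algHom_apply, ← hM]
  set p := (∏ a ∈ univ.image hH.eigenvalues, (X - C a))
  have hp : ∀ i, p.eval (hH.eigenvalues i) = 0 := by
    intro i
    rw [eval_prod, prod_eq_zero (i := hH.eigenvalues i) (by simp)]
    simp
  have h1 := hH.spectral_theorem
  have h2 : aeval (Matrix.diagonal hH.eigenvalues) p = 0 := by
    have : Matrix.diagonal hH.eigenvalues = Matrix.diagonalAlgHom ℝ hH.eigenvalues := rfl
    rw [this, aeval_algHom_apply]
    have : aeval hH.eigenvalues p = 0 := by
      funext i
      have h3 := aeval_algHom_apply (Pi.evalAlgHom ℝ (fun _ : G => ℝ) i) hH.eigenvalues p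
      simp only [Pi.evalAlgHom_apply] at h3
      rw [← h3, Pi.zero_apply, ← hp i, coe_aeval_eq_eval]
    rw [this, map_zero]
  have h3 : M = Unitary.conjStarAlgAut ℝ _ hH.eigenvectorUnitary (Matrix.diagonal hH.eigenvalues) := h1
  rw [h3, aeval_algHom_apply, h2, map_zero]

/-- spectral projections -/
lemma spec_proj {x : MonoidAlgebra ℝ G} (hx : st x = x) :
    ∃ (S : Finset ℝ) (P : ℝ → ℝ[X]), (∀ a ∉ S, aeval x (P a) = 0) ∧ ∑ a ∈ S, aeval x (P a) = 1 ∧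
      ∀ a, x * aeval x (P a) = a • aeval x (P a) := by
  obtain ⟨S, hS⟩ := spec_ann hx
  refine ⟨S, fun a => if a ∈ S then Lagrange.basis S id a else 0, ?_, ?_, ?_⟩
  · intro a ha; simp [ha]
  · rcases S.eq_empty_or_nonempty with h | h
    · subst h
      have h0 : (1 : MonoidAlgebra ℝ G) = 0 := by simp at hS
      simp [h0]
    · rw [← map_sum]
      rw [sum_congr rfl (fun a ha => if_pos ha)]
      rw [Lagrange.sum_basis (Set.injOn_id _) h, map_one]
  · intro a
    by_cases ha : a ∈ S
    · simp only [ha, if_true]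
      have : (X - C a) * Lagrange.basis S id a ∈ Ideal.span {∏ a ∈ S, (X - C a)} := by
        rw [Ideal.mem_span_singleton, ← mul_prod_erase S _ ha]
        apply mul_dvd_mul_left
        rw [Lagrange.basis]
        apply prod_dvd_prod_of_dvd
        intro b hb
        rw [Lagrange.basisDivisor]
        exact dvd_mul_left _ _
      rw [Ideal.mem_span_singleton] at this
      obtain ⟨c, hc⟩ := this
      have h := congrArg (aeval x) hc
      rw [map_mul, map_mul, hS, zero_mul, map_sub, aeval_X, aeval_C, sub_mul, sub_eq_zero] at h
      rw [h, Algebra.smul_def]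
    · simp [ha]

lemma proj_orth {x : MonoidAlgebra ℝ G} {S : Finset ℝ} {P : ℝ → MonoidAlgebra ℝ G} 
    (h0 : ∀ a ∉ S, P a = 0) (h1 : ∑ a ∈ S, P a = 1) (h2 : ∀ a, x * P a = a • P a)
    (h3 : ∀ a, Commute x (P a)) (a b : ℝ) : P a * P b = if a = b then P a else 0 := by
  have key : ∀ a b, a ≠ b → P a * P b = 0 := by
    intro a b hab
    have e1 : x * (P a * P b) = a • (P a * P b) := by rw [← mul_assoc, h2, smul_mul_assoc]
    have e2 : x * (P a * P b) = b • (P a * P b) := by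
      rw [← mul_assoc, (h3 a).eq, mul_assoc, h2, mul_smul_comm]
    rw [e1, ← sub_eq_zero, ← sub_smul, smul_eq_zero, sub_eq_zero] at e2
    exact e2.resolve_left hab
  split_ifs with h
  · subst h
    by_cases ha : a ∈ S
    · conv_rhs => rw [← mul_one (P a), ← h1, mul_sum]
      rw [sum_eq_single a (fun b _ hb => key a b hb.symm) (fun h => (h ha).elim)]
    · rw [h0 a ha, mul_zero]
  · exact key a b h

/-- subalgebra of a subgroup -/
noncomputable def Su (H : Subgroup G) : Subalgebra ℝ (MonoidAlgebra ℝ G) := Algebra.adjoin ℝ (dl '' (H : Set G))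

lemma dl_mem {H : Subgroup G} {g : G} (h : g ∈ H) : dl g ∈ Su H := Algebra.subset_adjoin ⟨g, h, rfl⟩

lemma Su_mono {H K : Subgroup G} (h : H ≤ K) : Su H ≤ Su K := Algebra.adjoin_mono (Set.image_mono h)

lemma Su_comm {H : Subgroup G} {x : MonoidAlgebra ℝ G} (h : ∀ g ∈ H, Commute x (dl g)) {a : MonoidAlgebra ℝ G}
    (ha : a ∈ Su H) : Commute x a := by
  induction ha using Algebra.adjoin_induction with
  | mem y hy => obtain ⟨g, hg, rfl⟩ := hy; exact h g hg
  | algebraMap r => exact (Algebra.commutes r x).symm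
  | add x y _ _ hx hy => exact hx.add_right hy
  | mul x y _ _ hx hy => exact hx.mul_right hy

open Classical in
noncomputable def Ep (H : Subgroup G) : MonoidAlgebra ℝ G →ₗ[ℝ] MonoidAlgebra ℝ G :=
  (MonoidAlgebra.basis G ℝ).constr ℝ (fun g => if g ∈ H then dl g else 0)

open Classical in
lemma Ep_dl (H : Subgroup G) (g : G) : Ep H (dl g) = if g ∈ H then dl g else 0 := by
  have := (MonoidAlgebra.basis G ℝ).constr_basis ℝ (fun g => if g ∈ H then dl g else 0) g
  exact this

lemma Ep_mem (H : Subgroup G) (x : MonoidAlgebra ℝ G) : Ep H x ∈ Su H := by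
  induction x using A_ind with
  | h1 g =>
    rw [Ep_dl]; split_ifs with h
    · exact dl_mem h
    · exact zero_mem _
  | h2 x y hx hy => rw [map_add]; exact add_mem hx hy
  | h3 c x hx => rw [map_smul]; exact Subalgebra.smul_mem _ hx c

lemma Ep_left {H : Subgroup G} {a : MonoidAlgebra ℝ G} (ha : a ∈ Su H) (x : MonoidAlgebra ℝ G) :
    Ep H (a * x) = a * Ep H x := by
  induction ha using Algebra.adjoin_induction generalizing x with
  | mem y hy =>
    obtain ⟨g, hg, rfl⟩ := hy
    induction x using A_ind with
    | h1 h =>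
      rw [dl_mul, Ep_dl, Ep_dl, H.mul_mem_cancel_left hg]
      split_ifs <;> simp [dl_mul]
    | h2 x y hx hy => rw [mul_add, map_add, map_add, mul_add, hx, hy]
    | h3 c x hx => rw [mul_smul_comm, map_smul, map_smul, mul_smul_comm, hx]
  | algebraMap r => rw [← Algebra.smul_def, map_smul, Algebra.smul_def]
  | add a b _ _ hx hy => rw [add_mul, add_mul, map_add, hx, hy]
  | mul a b _ _ hx hy => rw [mul_assoc, hx, hy, mul_assoc]

lemma Ep_right {H : Subgroup G} {a : MonoidAlgebra ℝ G} (ha : a ∈ Su H) (x : MonoidAlgebra ℝ G) :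
    Ep H (x * a) = Ep H x * a := by
  induction ha using Algebra.adjoin_induction generalizing x with
  | mem y hy =>
    obtain ⟨g, hg, rfl⟩ := hy
    induction x using A_ind with
    | h1 h =>
      rw [dl_mul, Ep_dl, Ep_dl, H.mul_mem_cancel_right hg]
      split_ifs <;> simp [dl_mul]
    | h2 x y hx hy => rw [add_mul, map_add, map_add, add_mul, hx, hy]
    | h3 c x hx => rw [smul_mul_assoc, map_smul, map_smul, smul_mul_assoc, hx]
  | algebraMap r => rw [← Algebra.commutes, ← Algebra.smul_def, map_smul, ← Algebra.commutes, Algebra.smul_def]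
  | add a b _ _ hx hy => rw [mul_add, mul_add, map_add, hx, hy]
  | mul a b _ _ hx hy => rw [← mul_assoc, hy, hx, mul_assoc]

lemma Ep_self {H : Subgroup G} {a : MonoidAlgebra ℝ G} (ha : a ∈ Su H) : Ep H a = a := by
  rw [← mul_one a, Ep_left ha, ← dl_one, Ep_dl, if_pos H.one_mem]

lemma tr_Ep (H : Subgroup G) (x : MonoidAlgebra ℝ G) : tr (Ep H x) = tr x := by
  induction x using A_ind with
  | h1 g =>
    rw [Ep_dl]; split_ifs with h
    · rfl
    · rw [tr_dl, if_neg, map_zero]; rintro rfl; exact h H.one_mem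
  | h2 x y hx hy => simp only [map_add, hx, hy]
  | h3 c x hx => simp only [map_smul, hx]

end grp
end WC

end

section
open Finset Polynomial

namespace WC

abbrev Al (N : ℕ) := MonoidAlgebra ℝ (Equiv.Perm (Fin N))

def Stb (N r : ℕ) : Subgroup (Equiv.Perm (Fin N)) where
  carrier := {g | ∀ i : Fin N, r ≤ (i : ℕ) → g i = i}
  mul_mem' := by
    intro a b ha hb i hi
    rw [Equiv.Perm.mul_apply, hb i hi, ha i hi]
  one_mem' := by intro i _; rfl
  inv_mem' := by
    intro a ha i hi
    rw [Equiv.Perm.inv_eq_iff_eq, ha i hi]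

lemma mem_Stb {N r : ℕ} {g : Equiv.Perm (Fin N)} : g ∈ Stb N r ↔ ∀ i : Fin N, r ≤ (i : ℕ) → g i = i := Iff.rfl

lemma Stb_mono {N r s : ℕ} (h : r ≤ s) : Stb N r ≤ Stb N s := fun _ hg i hi => hg i (h.trans hi)

lemma Stb_top (N : ℕ) : Stb N N = ⊤ := by
  rw [eq_top_iff]; intro g _ i hi
  have := i.2; omega

lemma Stb_lt {N r : ℕ} {g : Equiv.Perm (Fin N)} (hg : g ∈ Stb N r) {i : Fin N} (hi : (i : ℕ) < r) : (g i : ℕ) < r := by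
  by_contra h
  have h1 := hg (g i) (not_lt.1 h)
  have := g.injective h1
  rw [this] at h; exact h hi

lemma swap_mem {N r : ℕ} {i j : Fin N} (hi : (i : ℕ) < r) (hj : (j : ℕ) < r) : Equiv.swap i j ∈ Stb N r := by
  intro k hk
  apply Equiv.swap_apply_of_ne_of_ne
  · rintro rfl; omega
  · rintro rfl; omega

noncomputable def J (N r : ℕ) : Al N := if h : r < N then ∑ i ∈ Iio (⟨r, h⟩ : Fin N), dl (Equiv.swap i ⟨r, h⟩) else 0

lemma J_eq {N r : ℕ} (h : r < N) : J N r = ∑ i ∈ Iio (⟨r, h⟩ : Fin N), dl (Equiv.swap i ⟨r, h⟩) := dif_pos h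

lemma J_zero (N : ℕ) : J N 0 = 0 := by
  unfold J
  split_ifs with h
  · apply sum_eq_zero
    intro i hi
    rw [mem_Iio, Fin.lt_def] at hi
    simp at hi
  · rfl

lemma st_J (N r : ℕ) : st (J N r) = J N r := by
  unfold J
  split_ifs with h
  · rw [map_sum]; apply sum_congr rfl; intro i _; rw [st_dl, Equiv.swap_inv]
  · simp

lemma J_mem (N r : ℕ) : J N r ∈ Su (Stb N (r + 1)) := by
  unfold J
  split_ifs with h
  · apply sum_mem
    intro i hi
    rw [mem_Iio, Fin.lt_def] at hi
    apply dl_mem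
    apply swap_mem <;> simp at * ; omega
  · exact zero_mem _

lemma J_comm_dl {N r : ℕ} {g : Equiv.Perm (Fin N)} (hg : g ∈ Stb N r) : Commute (J N r) (dl g) := by
  by_cases h : r < N
  · rw [J_eq h]
    unfold Commute SemiconjBy
    rw [sum_mul, mul_sum]
    apply sum_nbij' (fun i => g⁻¹ i) (fun i => g i)
    · intro i hi
      rw [mem_Iio, Fin.lt_def] at *
      exact Stb_lt (inv_mem hg) hi
    · intro i hi
      rw [mem_Iio, Fin.lt_def] at *
      exact Stb_lt hg hi
    · intro i _; simp
    · intro i _; simp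
    · intro i hi
      rw [dl_mul, dl_mul]
      congr 1
      have h1 : g⁻¹ ⟨r, h⟩ = ⟨r, h⟩ := inv_mem hg ⟨r, h⟩ le_rfl
      have := Equiv.swap_apply_apply g⁻¹ i ⟨r, h⟩
      rw [h1] at this
      rw [this]; group
  · unfold J; rw [dif_neg h]; exact Commute.zero_left _

lemma J_comm {N r : ℕ} {a : Al N} (ha : a ∈ Su (Stb N r)) : Commute (J N r) a :=
  Su_comm (fun _ hg => J_comm_dl hg) ha

noncomputable def sw (N r : ℕ) : Equiv.Perm (Fin N) := if h : r + 1 < N then Equiv.swap ⟨r, by omega⟩ ⟨r + 1, h⟩ else 1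

lemma sw_eq {N r : ℕ} (h : r + 1 < N) : sw N r = Equiv.swap ⟨r, by omega⟩ ⟨r + 1, h⟩ := dif_pos h

lemma sw_sq (N r : ℕ) : sw N r * sw N r = 1 := by
  unfold sw; split_ifs <;> simp

lemma dsw_sq (N r : ℕ) : (dl (sw N r) : Al N) * dl (sw N r) = 1 := by rw [dl_mul, sw_sq]; rfl

lemma J_succ {N r : ℕ} (h : r + 1 < N) : J N (r + 1) * dl (sw N r) = dl (sw N r) * J N r + 1 := by
  have hr : r < N := by omega
  have h1 : Iio (⟨r + 1, h⟩ : Fin N) = insert (⟨r, hr⟩ : Fin N) (Iio ⟨r, hr⟩) := by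
    ext i; simp only [mem_Iio, mem_insert, Fin.lt_def, Fin.ext_iff]; omega
  rw [J_eq h, J_eq hr, h1, sum_insert (by simp), add_mul, add_comm, sum_mul, mul_sum, ← sw_eq h, dsw_sq]
  congr 1
  apply sum_congr rfl
  intro i hi
  rw [mem_Iio, Fin.lt_def] at hi
  rw [dl_mul, dl_mul]
  congr 1
  have := Equiv.swap_apply_apply (sw N r) i ⟨r, hr⟩
  rw [show sw N r i = i from ?_, show sw N r ⟨r, hr⟩ = ⟨r + 1, h⟩ from ?_] at this
  · rw [this]; group
  · rw [sw_eq h, Equiv.swap_apply_left]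
  · rw [sw_eq h]
    apply Equiv.swap_apply_of_ne_of_ne <;> rw [ne_eq, Fin.ext_iff] <;> simp at * <;> omega

lemma Ep_conj {N r : ℕ} (h : r + 1 < N) (x : Al N) (hx : x ∈ Su (Stb N (r + 1))) :
    Ep (Stb N (r + 1)) (dl (sw N r) * x * dl (sw N r)) = Ep (Stb N r) x := by
  have hr : r < N := by omega
  rw [← Ep_self hx]
  clear hx
  have hs : sw N r ⟨r, hr⟩ = ⟨r + 1, h⟩ := by rw [sw_eq h, Equiv.swap_apply_left]
  have hs' : sw N r ⟨r + 1, h⟩ = ⟨r, hr⟩ := by rw [sw_eq h, Equiv.swap_apply_right]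
  have hs2 : ∀ i : Fin N, r + 2 ≤ (i : ℕ) → sw N r i = i := by
    intro i hi
    rw [sw_eq h]
    apply Equiv.swap_apply_of_ne_of_ne <;> rw [ne_eq, Fin.ext_iff] <;> simp <;> omega
  induction x using A_ind with
  | h1 g =>
    rw [Ep_dl]
    split_ifs with hg
    · rw [dl_mul, dl_mul, Ep_dl, Ep_dl]
      have hiff : sw N r * g * sw N r ∈ Stb N (r + 1) ↔ g ∈ Stb N r := by
        constructor
        · intro h1 i hi
          rcases hi.lt_or_eq with h2 | h2
          · exact hg i h2
          · have h3 := h1 ⟨r + 1, h⟩ le_rfl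
            have h4 : i = ⟨r, hr⟩ := Fin.ext h2.symm
            rw [Equiv.Perm.mul_apply, Equiv.Perm.mul_apply, hs', ← hs] at h3
            rw [h4]; exact (sw N r).injective h3
        · intro h1 i hi
          rw [Equiv.Perm.mul_apply, Equiv.Perm.mul_apply]
          rcases hi.lt_or_eq with h2 | h2
          · rw [hs2 i h2, hg i hi, hs2 i h2]
          · have h4 : i = ⟨r + 1, h⟩ := Fin.ext h2.symm
            rw [h4, hs', h1 ⟨r, hr⟩ le_rfl, hs]
      by_cases h1 : g ∈ Stb N r
      · rw [if_pos h1, if_pos (hiff.2 h1)]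
        congr 1
        ext i
        have e : ∀ i, sw N r (sw N r i) = i := fun i => by rw [← Equiv.Perm.mul_apply, sw_sq]; rfl
        congr 1
        rw [Equiv.Perm.mul_apply, Equiv.Perm.mul_apply]
        by_cases hi : (i : ℕ) < r
        · have e1 : ∀ j : Fin N, (j : ℕ) < r → sw N r j = j := by
            intro j hj
            rw [sw_eq h]
            apply Equiv.swap_apply_of_ne_of_ne <;> rw [ne_eq, Fin.ext_iff] <;> simp <;> omega
          rw [e1 i hi, e1 _ (Stb_lt h1 hi)]
        · rw [h1 i (not_lt.1 hi)]
          have e2 : r ≤ ((sw N r i : Fin N) : ℕ) := by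
            rw [not_lt] at hi
            rcases hi.lt_or_eq with h2 | h2
            · rcases (Nat.succ_le_iff.2 h2).lt_or_eq with h3 | h3
              · rw [hs2 i h3]; exact hi
              · have h4 : i = ⟨r + 1, h⟩ := Fin.ext h3.symm
                rw [h4, hs']
            · have h4 : i = ⟨r, hr⟩ := Fin.ext h2.symm
              rw [h4, hs]; simp
          rw [h1 _ e2, e]
      · rw [if_neg h1, if_neg (fun h => h1 (hiff.1 h))]
    · simp
  | h2 x y hx hy => simp only [map_add, mul_add, add_mul, hx, hy]
  | h3 c x hx => simp only [map_smul, mul_smul_comm, smul_mul_assoc, hx]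

lemma Ep_sw {N r : ℕ} (h : r + 1 < N) : Ep (Stb N (r + 1)) (dl (sw N r)) = 0 := by
  rw [Ep_dl, if_neg]
  intro h1
  have := h1 ⟨r + 1, h⟩ le_rfl
  rw [sw_eq h, Equiv.swap_apply_right] at this
  simp [Fin.ext_iff] at this

noncomputable def K (N : ℕ) : ℕ → ℝ → Al N
  | 0, _ => 1
  | r + 1, q => (algebraMap ℝ _ q + J N r) * K N r q

lemma K_mem (N r : ℕ) (q : ℝ) : K N r q ∈ Su (Stb N r) := by
  induction r with
  | zero => exact one_mem _
  | succ r ih =>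
    exact mul_mem (add_mem (Subalgebra.algebraMap_mem _ _) (J_mem N r)) (Su_mono (Stb_mono (Nat.le_succ r)) ih)

lemma res_rec {N r : ℕ} (h : r + 1 < N) (z : ℝ) {R R' : Al N} (hR : R ∈ Su (Stb N (r + 1)))
    (h1 : (algebraMap ℝ _ z - J N r) * R = 1) (h2 : R * (algebraMap ℝ _ z - J N r) = 1)
    (h1' : (algebraMap ℝ _ z - J N (r + 1)) * R' = 1) (h2' : R' * (algebraMap ℝ _ z - J N (r + 1)) = 1) :
    ((algebraMap ℝ _ z - J N r) ^ 2 - 1) * Ep (Stb N (r + 1)) R' =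
      (algebraMap ℝ _ z - J N r) ^ 2 * Ep (Stb N r) R := by
  set Z := algebraMap ℝ (Al N) z - J N r with hZ
  set Z' := algebraMap ℝ (Al N) z - J N (r + 1) with hZ'
  set s : Al N := dl (sw N r) with hs
  have hss : s * s = 1 := dsw_sq N r
  have hcomm : ∀ a ∈ Su (Stb N (r + 1)), a * R' = R' * a := by
    intro a ha
    have : Z' * a = a * Z' := by
      rw [hZ', sub_mul, mul_sub, (J_comm ha).eq, Algebra.commutes]
    calc a * R' = (R' * Z') * a * R' := by rw [h2', one_mul]
      _ = R' * (Z' * a) * R' := by noncomm_ring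
      _ = R' * a * (Z' * R') := by rw [this]; noncomm_ring
      _ = R' * a := by rw [h1', mul_one]
  have hZs : Z' * s = s * Z - 1 := by
    rw [hZ', hZ, sub_mul, mul_sub, J_succ h, Algebra.commutes]; noncomm_ring
  have e1 : R' * s = s * R + R' * R := by
    have : R' * (Z' * s) * R = R' * (s * Z - 1) * R := by rw [hZs]
    rw [← mul_assoc, h2', one_mul, mul_sub, sub_mul, mul_one, mul_assoc, mul_assoc, h1, mul_one] at this
    rw [this]; abel
  have e2 : R' = s * R * s + R * s * R + R * R' * R := by
    calc R' = (R' * s) * s := by rw [mul_assoc, hss, mul_one]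
      _ = s * R * s + (R' * R) * s := by rw [e1, add_mul]
      _ = s * R * s + R * (R' * s) := by rw [← hcomm R hR, mul_assoc R R' s]
      _ = _ := by rw [e1]; noncomm_ring
  have e3 : Ep (Stb N (r + 1)) R' = Ep (Stb N r) R + R * Ep (Stb N (r + 1)) R' * R := by
    conv_lhs => rw [e2]
    rw [map_add, map_add, Ep_conj h R hR, Ep_right hR, Ep_left hR, Ep_right hR, Ep_left hR, Ep_sw h]
    simp
  set Y := Ep (Stb N (r + 1)) R' with hY
  have hZm : Z ∈ Su (Stb N (r + 1)) := sub_mem (Subalgebra.algebraMap_mem _ _) (J_mem N r)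
  have hYZ : Z * Y = Y * Z := by
    rw [hY, ← Ep_left hZm, ← Ep_right hZm, hcomm Z hZm]
  have hEZ : Z * Ep (Stb N r) R = Ep (Stb N r) R * Z := by
    rw [hZ, sub_mul, mul_sub, (J_comm (Ep_mem _ _)).eq, Algebra.commutes]
  have e4 : Z * Y * Z = Z * Ep (Stb N r) R * Z + Y := by
    calc Z * Y * Z = Z * (Ep (Stb N r) R + R * Y * R) * Z := by rw [← e3]
      _ = Z * Ep (Stb N r) R * Z + (Z * R) * Y * (R * Z) := by noncomm_ring
      _ = _ := by rw [h1, h2, one_mul, mul_one]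
  rw [sub_mul, one_mul, pow_two, mul_assoc, hYZ, ← mul_assoc, e4, mul_assoc, mul_assoc, hEZ]
  abel

lemma res_ex (N r : ℕ) : ∃ B : ℝ, ∀ z, B < z → ∃ R ∈ Su (Stb N (r + 1)),
    (algebraMap ℝ (Al N) z - J N r) * R = 1 ∧ R * (algebraMap ℝ _ z - J N r) = 1 := by
  obtain ⟨S, P, h0, h1, h2⟩ := spec_proj (st_J N r)
  refine ⟨∑ a ∈ S, |a|, fun z hz => ⟨∑ a ∈ S, (z - a)⁻¹ • aeval (J N r) (P a), ?_, ?_, ?_⟩⟩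
  · apply sum_mem
    intro a _
    apply Subalgebra.smul_mem
    have := (aeval (⟨J N r, J_mem N r⟩ : Su (Stb N (r + 1))) (P a)).2
    rwa [← Subalgebra.val_apply, ← aeval_algHom_apply] at this
  all_goals
    have hne : ∀ a ∈ S, z - a ≠ 0 := by
      intro a ha h
      have := single_le_sum (f := fun a : ℝ => |a|) (fun _ _ => abs_nonneg _) ha
      have := le_abs_self a
      linarith
  · rw [mul_sum, ← h1]
    apply sum_congr rfl
    intro a ha
    rw [mul_smul_comm, sub_mul, h2, ← Algebra.smul_def, ← sub_smul, smul_smul, inv_mul_cancel₀ (hne a ha), one_smul]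
  · rw [sum_mul, ← h1]
    apply sum_congr rfl
    intro a ha
    have hc : aeval (J N r) (P a) * J N r = J N r * aeval (J N r) (P a) := by
      have := congrArg (aeval (J N r)) (mul_comm (P a) X)
      rwa [map_mul, map_mul, aeval_X] at this
    rw [smul_mul_assoc, mul_sub, hc, h2, ← Algebra.commutes, ← Algebra.smul_def, ← sub_smul, smul_smul, inv_mul_cancel₀ (hne a ha), one_smul]

lemma res_id (N r : ℕ) (hr : r < N) : ∃ B : ℝ, ∀ z, B < z → ∃ R ∈ Su (Stb N (r + 1)),
    (algebraMap ℝ (Al N) z - J N r) * R = 1 ∧ R * (algebraMap ℝ _ z - J N r) = 1 ∧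
    z • (K N r (1 - z) * K N r (-1 - z) * Ep (Stb N r) R) = K N r (-z) ^ 2 := by
  induction r with
  | zero =>
    obtain ⟨B, hB⟩ := res_ex N 0
    refine ⟨B, fun z hz => ?_⟩
    obtain ⟨R, hR, h1, h2⟩ := hB z hz
    refine ⟨R, hR, h1, h2, ?_⟩
    rw [J_zero, sub_zero, ← Algebra.smul_def] at h1
    simp only [K]
    rw [one_mul, one_mul, ← map_smul, h1, Ep_self (one_mem _)]; simp
  | succ r ih =>
    obtain ⟨B₁, h₁⟩ := ih (by omega)
    obtain ⟨B₂, h₂⟩ := res_ex N (r + 1)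
    refine ⟨max B₁ B₂, fun z hz => ?_⟩
    obtain ⟨R, hR, a1, a2, a3⟩ := h₁ z ((le_max_left _ _).trans_lt hz)
    obtain ⟨R', hR', b1, b2⟩ := h₂ z ((le_max_right _ _).trans_lt hz)
    refine ⟨R', hR', b1, b2, ?_⟩
    have key := res_rec hr z hR a1 a2 b1 b2
    have hc : ∀ q, J N r * K N r q = K N r q * J N r := fun q => (J_comm (K_mem N r q)).eq
    simp only [K]
    set Y' := Ep (Stb N (r + 1)) R'
    set Y := Ep (Stb N r) R
    set Jr := J N r
    set K1 := K N r (1 - z)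
    set K2 := K N r (-1 - z)
    set K0 := K N r (-z)
    set Z := algebraMap ℝ (Al N) z - Jr with hZ
    have z1 : algebraMap ℝ (Al N) (1 - z) + Jr = -(Z - 1) := by rw [hZ, map_sub, map_one]; abel
    have z2 : algebraMap ℝ (Al N) (-1 - z) + Jr = -(Z + 1) := by rw [hZ, map_sub, map_neg, map_one]; abel
    have z0 : algebraMap ℝ (Al N) (-z) + Jr = -Z := by rw [hZ, map_neg]; abel
    have cz : ∀ q, Z * K N r q = K N r q * Z := by
      intro q; rw [hZ, sub_mul, mul_sub, hc, Algebra.commutes]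
    have cz1 : Z * K1 = K1 * Z := cz _
    have cz2 : Z * K2 = K2 * Z := cz _
    have cz0 : Z * K0 = K0 * Z := cz _
    rw [z1, z2, z0]
    have step : -(Z - 1) * K1 * (-(Z + 1) * K2) * Y' = K1 * K2 * ((Z ^ 2 - 1) * Y') := by
      have e : (Z + 1) * K2 = K2 * (Z + 1) := by rw [add_mul, mul_add, cz2, one_mul, mul_one]
      have e1 : (Z - 1) * K1 = K1 * (Z - 1) := by rw [sub_mul, mul_sub, cz1, one_mul, mul_one]
      have e2 : (Z - 1) * K2 = K2 * (Z - 1) := by rw [sub_mul, mul_sub, cz2, one_mul, mul_one]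
      calc -(Z - 1) * K1 * (-(Z + 1) * K2) * Y' = ((Z - 1) * K1) * ((Z + 1) * K2) * Y' := by noncomm_ring
        _ = K1 * ((Z - 1) * K2) * (Z + 1) * Y' := by rw [e, e1]; noncomm_ring
        _ = _ := by rw [e2]; noncomm_ring
    rw [step, key]
    have step2 : K1 * K2 * (Z ^ 2 * Y) = Z ^ 2 * (K1 * K2 * Y) := by
      have : Commute (Z ^ 2) (K1 * K2) := Commute.pow_left (Commute.mul_right cz1 cz2) 2
      rw [← mul_assoc, ← this.eq, mul_assoc]
    rw [step2, ← mul_smul_comm, a3]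
    have : Commute Z K0 := cz0
    rw [neg_mul, neg_sq, this.mul_pow]

end WC

end

section
open Finset Polynomial

namespace WC

def nc {n : ℕ} (π : Equiv.Perm (Fin n)) : ℕ :=
  Multiset.card π.cycleType + (Finset.univ.filter fun i => π i = i).card

lemma nc_eq {n : ℕ} (π : Equiv.Perm (Fin n)) : nc π + π.cycleType.sum = Multiset.card π.cycleType + n := by
  rw [Equiv.Perm.sum_cycleType, nc]
  have h := card_filter_add_card_filter_not (s := (univ : Finset (Fin n))) (fun i => π i = i)
  have h2 : π.support = univ.filter (fun i => ¬ π i = i) := by ext; simp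
  rw [h2]
  simp only [card_univ, Fintype.card_fin] at h
  omega

lemma nc_swap {n : ℕ} (π : Equiv.Perm (Fin n)) (x : Fin n) (hx : π x ≠ x) :
    nc (Equiv.swap x (π x) * π) = nc π + 1 := by
  set c := π.cycleOf x with hc
  have hcm : c ∈ π.cycleFactorsFinset := by
    rw [hc, Equiv.Perm.cycleOf_mem_cycleFactorsFinset_iff]; simpa using hx
  have hcc : c.IsCycle := Equiv.Perm.isCycle_cycleOf π hx
  have hd := Equiv.Perm.disjoint_mul_inv_of_mem_cycleFactorsFinset hcm
  set ρ := π * c⁻¹ with hρ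
  have hπ : π = c * ρ := by rw [← hd.commute.eq, hρ]; group
  have hcx : c x = π x := Equiv.Perm.cycleOf_apply_self π x
  have hcx' : c x ≠ x := by rw [hcx]; exact hx
  have e1 := nc_eq π
  have e2 := nc_eq (Equiv.swap x (π x) * π)
  have e3 : π.cycleType = c.cycleType + ρ.cycleType := by
    rw [hπ]; exact hd.symm.cycleType_mul
  have e4 : Equiv.swap x (π x) * π = (Equiv.swap x (c x) * c) * ρ := by
    rw [hcx, mul_assoc, ← hπ]
  rw [hcc.cycleType] at e3
  rw [e3] at e1
  simp only [Multiset.sum_add, Multiset.card_add] at e1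
  by_cases hccx : c (c x) = x
  · have h1 : c = Equiv.swap x (c x) := Equiv.Perm.IsCycle.eq_swap_of_apply_apply_eq_self hcc hcx' hccx
    have h2 : Equiv.swap x (c x) * c = 1 := by
      conv_lhs => rw [← h1, h1]
      simp
    have h3 : c.support.card = 2 := by
      rw [Equiv.Perm.card_support_eq_two]; exact ⟨x, c x, hcx'.symm, h1⟩
    rw [e4, h2, one_mul] at e2 ⊢
    simp at e1
    rw [h3] at e1
    omega
  · have h1 : (Equiv.swap x (c x) * c).IsCycle := hcc.swap_mul hcx' hccx
    have h2 := Equiv.Perm.support_swap_mul_eq c x hccx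
    have h3 : (Equiv.swap x (c x) * c).Disjoint ρ := by
      rw [Equiv.Perm.disjoint_iff_disjoint_support, h2]
      exact ((Equiv.Perm.disjoint_iff_disjoint_support.1 hd.symm).mono_left sdiff_le)
    have h4 : (Equiv.swap x (c x) * c).support.card + 1 = c.support.card := by
      rw [h2, sdiff_singleton_eq_erase, card_erase_add_one]
      simpa using hcx'
    rw [e4, h3.cycleType_mul, h1.cycleType] at e2
    rw [e4]
    simp at e1 e2
    omega

def ec {N : ℕ} (r : ℕ) (π : Equiv.Perm (Fin N)) : ℕ :=
  Multiset.card π.cycleType + (Finset.univ.filter fun i : Fin N => (i : ℕ) < r ∧ π i = i).card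

lemma ec_nc {N r : ℕ} (hr : r ≤ N) {π : Equiv.Perm (Fin N)} (h : π ∈ Stb N r) : ec r π + (N - r) = nc π := by
  unfold ec nc
  rw [add_assoc]
  congr 1
  rw [← card_filter_add_card_filter_not (s := (univ.filter fun i => π i = i)) (fun i : Fin N => (i : ℕ) < r), filter_filter, filter_filter]
  congr 1
  · congr 1; ext; simp [and_comm]
  · have : (univ.filter fun i : Fin N => π i = i ∧ ¬ (i : ℕ) < r) = univ.filter fun i : Fin N => ¬ (i : ℕ) < r := by
      ext i; simp only [mem_filter, mem_univ, true_and, and_iff_right_iff_imp]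
      intro hi; exact h i (not_lt.1 hi)
    rw [this]
    have h2 := card_filter_add_card_filter_not (s := (univ : Finset (Fin N))) (fun i => (i : ℕ) < r)
    have h3 : (univ.filter fun i : Fin N => (i : ℕ) < r).card = r := by
      rw [Fin.card_filter_val_lt]; omega
    simp only [card_univ, Fintype.card_fin] at h2
    omega

lemma ec_top {N : ℕ} (π : Equiv.Perm (Fin N)) : ec N π = nc π := by
  unfold ec nc; simp

open Classical in
lemma K_sum {N r : ℕ} (hr : r ≤ N) (q : ℝ) : K N r q = ∑ g ∈ univ.filter (· ∈ Stb N r), q ^ (ec r g) • dl g := by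
  induction r with
  | zero =>
    have : (univ.filter (· ∈ Stb N 0)) = {1} := by
      ext g
      simp only [mem_filter, mem_univ, true_and, mem_singleton]
      constructor
      · intro h; ext i; rw [h i (Nat.zero_le _)]; rfl
      · rintro rfl; exact one_mem _
    rw [this, sum_singleton, K, dl_one]
    simp [ec]
  | succ r ih =>
    have hr' : r < N := hr
    set t : Fin N := ⟨r, hr'⟩ with ht
    have hst : ∀ i : Fin N, i ≤ t → ∀ g ∈ Stb N r, Equiv.swap i t * g ∈ Stb N (r + 1) := by
      intro i hi g hg
      exact mul_mem (swap_mem (by have : (i : ℕ) ≤ r := hi; omega) (by simp [ht])) (Stb_mono (Nat.le_succ r) hg)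
    have hJ : algebraMap ℝ (Al N) q + J N r = ∑ i ∈ Iic t, (if i = t then q else 1) • dl (Equiv.swap i t) := by
      have : Iic t = insert t (Iio t) := by ext; simp [le_iff_eq_or_lt]
      rw [this, sum_insert (by simp), J_eq hr']
      congr 1
      · rw [if_pos rfl, Equiv.swap_self, Algebra.algebraMap_eq_smul_one]; rfl
      · apply sum_congr rfl
        intro i hi
        rw [mem_Iio] at hi
        rw [if_neg hi.ne, one_smul]
    rw [K, ih hr'.le, hJ, sum_mul_sum, ← sum_product']
    apply sum_nbij' (fun p => Equiv.swap p.1 t * p.2) (fun g => (g t, Equiv.swap (g t) t * g))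
    · rintro ⟨i, g⟩ hp
      simp only [mem_product, mem_Iic, mem_filter, mem_univ, true_and] at *
      exact hst i hp.1 g hp.2
    · intro g hg
      simp only [mem_product, mem_Iic, mem_filter, mem_univ, true_and] at *
      have hgt : g t ≤ t := by
        have := Stb_lt hg (i := t) (by simp [ht])
        exact Nat.lt_succ_iff.1 this
      refine ⟨hgt, ?_⟩
      intro j hj
      rw [Equiv.Perm.mul_apply]
      rcases hj.lt_or_eq with h | h
      · rw [hg j h]
        apply Equiv.swap_apply_of_ne_of_ne
        · rintro rfl
          have : (g t : ℕ) ≤ r := hgt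
          omega
        · rintro rfl; simp [ht] at h
      · have : j = t := Fin.ext h.symm
        rw [this, Equiv.swap_apply_left]
    · rintro ⟨i, g⟩ hp
      simp only [mem_product, mem_Iic, mem_filter, mem_univ, true_and] at *
      have : g t = t := hp.2 t le_rfl
      simp [this]
    · intro g hg
      simp
    · rintro ⟨i, g⟩ hp
      simp only [mem_product, mem_Iic, mem_filter, mem_univ, true_and] at *
      have hgt : g t = t := hp.2 t le_rfl
      rw [smul_mul_smul_comm, dl_mul]
      congr 1
      have e1 := ec_nc hr'.le hp.2
      have e2 := ec_nc hr (hst i hp.1 g hp.2)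
      split_ifs with h
      · subst h
        rw [Equiv.swap_self, ← pow_succ']
        rw [Equiv.swap_self] at e2
        change ec (r + 1) g + _ = nc g at e2
        change _ = q ^ ec (r + 1) g
        congr 1; omega
      · have h1 : (Equiv.swap i t * g) t = i := by simp [hgt]
        have h2 := nc_swap (Equiv.swap i t * g) t (by rw [h1]; exact h)
        rw [h1, Equiv.swap_comm, Equiv.swap_mul_self_mul] at h2
        rw [one_mul]
        congr 1; omega

lemma ec_conj {N r : ℕ} {g h : Equiv.Perm (Fin N)} (hh : h ∈ Stb N r) : ec r (h * g * h⁻¹) = ec r g := by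
  unfold ec
  rw [Equiv.Perm.cycleType_conj]
  congr 1
  apply card_nbij' (fun i => h⁻¹ i) (fun i => h i)
  · intro i hi
    simp only [coe_filter, Set.mem_ofPred_eq, mem_univ, true_and] at *
    refine ⟨Stb_lt (inv_mem hh) hi.1, ?_⟩
    have := hi.2
    simp only [Equiv.Perm.mul_apply] at this
    rw [Equiv.Perm.eq_inv_iff_eq, this]
  · intro i hi
    simp only [coe_filter, Set.mem_ofPred_eq, mem_univ, true_and] at *
    exact ⟨Stb_lt hh hi.1, by simp [hi.2]⟩
  · intro i _; simp
  · intro i _; simp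

lemma K_comm_dl {N r : ℕ} (hr : r ≤ N) (q : ℝ) {h : Equiv.Perm (Fin N)} (hh : h ∈ Stb N r) :
    Commute (K N r q) (dl h) := by
  classical
  rw [K_sum hr]
  unfold Commute SemiconjBy
  rw [sum_mul, mul_sum]
  apply sum_nbij' (fun g => h⁻¹ * g * h) (fun g => h * g * h⁻¹)
  · intro g hg
    simp only [mem_filter, mem_univ, true_and] at *
    exact mul_mem (mul_mem (inv_mem hh) hg) hh
  · intro g hg
    simp only [mem_filter, mem_univ, true_and] at *
    exact mul_mem (mul_mem hh hg) (inv_mem hh)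
  · intro g _; group
  · intro g _; group
  · intro g _
    rw [smul_mul_assoc, mul_smul_comm, dl_mul, dl_mul]
    have := ec_conj (g := g) (inv_mem hh)
    rw [inv_inv] at this
    rw [this]
    congr 2; group

end WC

end

section
open Finset Polynomial

namespace WC

structure Inv (N r : ℕ) (e : (Fin N → ℕ) → Al N) : Prop where
  mem : ∀ f ∈ Sh N r, e f ∈ Su (Stb N r)
  sa : ∀ f ∈ Sh N r, st (e f) = e f
  sum : ∑ f ∈ Sh N r, e f = 1
  orth : ∀ f ∈ Sh N r, ∀ g ∈ Sh N r, e f * e g = if f = g then e f else 0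
  trr : ∀ f ∈ Sh N r, tr (e f) = (r.factorial : ℝ) * DD f ^ 2
  eig : ∀ f ∈ Sh N r, ∀ q, K N r q * e f = cp f q • e f

lemma Inv.eig' {N r : ℕ} {e : (Fin N → ℕ) → Al N} (h : Inv N r e) {f : Fin N → ℕ} (hf : f ∈ Sh N r) (q : ℝ) :
    e f * K N r q = cp f q • e f := by
  rw [← mul_one (K N r q), ← h.sum, mul_sum, mul_sum, sum_eq_single f]
  · rw [h.eig f hf, mul_smul_comm, h.orth f hf f hf, if_pos rfl]
  · intro g hg hne
    rw [h.eig g hg, mul_smul_comm, h.orth f hf g hg, if_neg hne.symm, smul_zero]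
  · intro h; exact (h hf).elim

lemma Inv.comm_dl {N r : ℕ} (hr : r ≤ N) {e : (Fin N → ℕ) → Al N} (h : Inv N r e) {f : Fin N → ℕ} (hf : f ∈ Sh N r)
    {g : Equiv.Perm (Fin N)} (hg : g ∈ Stb N r) : Commute (e f) (dl g) := by
  have key : ∀ a ∈ Sh N r, ∀ b ∈ Sh N r, a ≠ b → e a * dl g * e b = 0 := by
    intro a ha b hb hab
    obtain ⟨q, hq⟩ := cp_sep ha hb hab
    have h1 : e a * K N r q * dl g * e b = cp a q • (e a * dl g * e b) := by
      rw [h.eig' ha, smul_mul_assoc, smul_mul_assoc]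
    have h2 : e a * K N r q * dl g * e b = cp b q • (e a * dl g * e b) := by
      rw [mul_assoc (e a), (K_comm_dl hr q hg).eq, mul_assoc, mul_assoc, h.eig b hb]
      simp only [mul_smul_comm, mul_assoc]
    rw [h1, ← sub_eq_zero, ← sub_smul, smul_eq_zero, sub_eq_zero] at h2
    exact h2.resolve_left hq
  have h1 : e f * dl g = e f * dl g * e f := by
    conv_lhs => rw [← mul_one (e f * dl g), ← h.sum, mul_sum]
    rw [sum_eq_single f (fun b hb hne => key f hf b hb hne.symm) (fun h => (h hf).elim)]
  have h2 : dl g * e f = e f * dl g * e f := by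
    conv_lhs => rw [← one_mul (dl g * e f), ← h.sum, sum_mul]
    rw [sum_eq_single f (fun b hb hne => by rw [← mul_assoc]; exact key b hb f hf hne) (fun h => (h hf).elim), mul_assoc]
  exact h1.trans h2.symm

lemma Inv.comm {N r : ℕ} (hr : r ≤ N) {e : (Fin N → ℕ) → Al N} (h : Inv N r e) {f : Fin N → ℕ} (hf : f ∈ Sh N r)
    {a : Al N} (ha : a ∈ Su (Stb N r)) : Commute (e f) a :=
  Su_comm (fun _ hg => h.comm_dl hr hf hg) ha

lemma inv_zero (N : ℕ) : Inv N 0 (fun _ => 1) where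
  mem := fun _ _ => one_mem _
  sa := fun _ _ => st_one
  sum := by simp [Sh_zero]
  orth := by
    intro f hf g hg
    rw [Sh_zero, mem_singleton] at hf hg
    rw [hf, hg]; simp
  trr := by
    intro f hf
    rw [Sh_zero, mem_singleton] at hf
    rw [hf, DD_init, ← dl_one, tr_dl]; simp
  eig := by
    intro f hf q
    rw [Sh_zero, mem_singleton] at hf
    rw [hf]; simp [K, cp]

lemma aeval_comm {N : ℕ} {x y : Al N} (h : Commute x y) (p : ℝ[X]) : Commute (aeval x p) y := by
  rw [aeval_eq_sum_range]
  apply Commute.sum_left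
  intro i _
  exact (h.pow_left i).smul_left _

lemma tr_key {N r : ℕ} (hr : r < N) {e : (Fin N → ℕ) → Al N} (h : Inv N r e) {S : Finset ℝ} {P : ℝ → Al N}
    (h0 : ∀ a ∉ S, P a = 0) (h1 : ∑ a ∈ S, P a = 1) (h2 : ∀ a, J N r * P a = a • P a)
    {v : Fin N → ℕ} (hv : v ∈ Sh N r) (a : ℝ) :
    tr (e v * P a) = ∑ i, if yy v i = a then (r.factorial : ℝ) * DD v * DD (ad v i) else 0 := by
  classical
  obtain ⟨B, hB⟩ := res_id N r hr
  have main : ∀ z, max B (N + 1) < z → ∑ a ∈ S, tr (e v * P a) / (z - a) =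
      ∑ i, ((r.factorial : ℝ) * DD v * DD (ad v i)) / (z - yy v i) := by
    intro z hz
    obtain ⟨R, hR, r1, r2, r3⟩ := hB z ((le_max_left _ _).trans_lt hz)
    have hzN : (N + 1 : ℝ) < z := (le_max_right _ _).trans_lt hz
    have hrN : (r : ℝ) + 1 ≤ N := by exact_mod_cast hr
    have hr0 : (0 : ℝ) ≤ r := by positivity
    have hRP : ∀ a, R * P a = (z - a)⁻¹ • P a := by
      intro a
      have e1 : (algebraMap ℝ (Al N) z - J N r) * P a = (z - a) • P a := by
        rw [sub_mul, h2, ← Algebra.smul_def, sub_smul]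
      have e2 : P a = (z - a) • (R * P a) := by
        rw [← mul_smul_comm, ← e1, ← mul_assoc, r2, one_mul]
      by_cases hza : z - a = 0
      · rw [hza, zero_smul] at e2
        rw [e2]; simp
      · conv_rhs => rw [e2]
        rw [smul_smul, inv_mul_cancel₀ hza, one_smul]
    have hRe : R = ∑ a ∈ S, (z - a)⁻¹ • P a := by
      rw [← mul_one R, ← h1, mul_sum]
      exact sum_congr rfl fun a _ => hRP a
    have hL : tr (e v * R) = ∑ a ∈ S, tr (e v * P a) / (z - a) := by
      rw [hRe, mul_sum, map_sum]
      apply sum_congr rfl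
      intro a _
      rw [mul_smul_comm, map_smul, smul_eq_mul]; field_simp
    have hcomm := h.comm hr.le hv (Ep_mem (Stb N r) R)
    have e3 : (z * (cp v (1 - z) * cp v (-1 - z))) • (e v * Ep (Stb N r) R) = (cp v (-z) ^ 2) • e v := by
      have e4 := congrArg (fun x => x * e v) r3
      rw [smul_mul_assoc, mul_assoc, ← hcomm.eq, mul_assoc, ← mul_assoc (K N r (-1 - z)), h.eig v hv,
        smul_mul_assoc, mul_smul_comm, ← mul_assoc, h.eig v hv, smul_mul_assoc, smul_smul, smul_smul,
        pow_two, mul_assoc (K N r (-z)), h.eig v hv, mul_smul_comm, h.eig v hv, smul_smul] at e4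
      rw [pow_two, ← e4]; congr 1; ring
    have e5 := congrArg tr e3
    rw [map_smul, map_smul, ← Ep_left (h.mem v hv), tr_Ep, hL, h.trr v hv, smul_eq_mul, smul_eq_mul] at e5
    have hG := G_id hr hv z hzN
    have c1 : cp v (1 - z) ≠ 0 := by
      have := cp_ne hv (z - 1) (by linarith)
      rwa [neg_sub] at this
    have c2 : cp v (-1 - z) ≠ 0 := by
      have := cp_ne hv (z + 1) (by linarith)
      rwa [neg_add, ← sub_eq_add_neg, show -z - 1 = -1 - z by ring] at this
    have c3 : z * (cp v (1 - z) * cp v (-1 - z)) ≠ 0 := mul_ne_zero (by linarith) (mul_ne_zero c1 c2)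
    apply mul_left_cancel₀ c3
    rw [e5]
    have : ∑ i, ((r.factorial : ℝ) * DD v * DD (ad v i)) / (z - yy v i) =
       (r.factorial : ℝ) * DD v * ∑ i, DD (ad v i) / (z - yy v i) := by
      rw [mul_sum]; apply sum_congr rfl; intros; ring
    rw [this]
    linear_combination (-(r.factorial : ℝ) * DD v) * hG
  by_cases ha : a ∈ S ∪ univ.image (yy v)
  · have := pf_unique (S ∪ univ.image (yy v)) (fun a => tr (e v * P a) - ∑ i, if yy v i = a then (r.factorial : ℝ) * DD v * DD (ad v i) else 0)
      (max B (N + 1)) (fun z hz => ?_) a ha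
    · exact sub_eq_zero.1 this
    · have m := main z hz
      simp only [sub_div]
      rw [sum_sub_distrib, sub_eq_zero]
      rw [← sum_subset (subset_union_left (s₁ := S) (s₂ := univ.image (yy v))) (by
        intro a _ ha; rw [h0 a ha]; simp), m]
      simp only [sum_div]
      rw [sum_comm]
      apply sum_congr rfl
      intro i _
      rw [sum_eq_single (yy v i)]
      · simp
      · intro b _ hb; rw [if_neg hb.symm, zero_div]
      · intro h; exact (h (by simp)).elim
  · rw [mem_union, not_or] at ha
    rw [h0 a ha.1, mul_zero, map_zero, sum_eq_zero]
    intro i _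
    rw [if_neg]; rintro rfl; exact ha.2 (by simp)

lemma inv_succ {N r : ℕ} (hr : r < N) {e : (Fin N → ℕ) → Al N} (h : Inv N r e) : ∃ e', Inv N (r + 1) e' := by
  classical
  obtain ⟨S, P0, h0, h1, h2⟩ := spec_proj (st_J N r)
  obtain ⟨P, hP⟩ : ∃ P : ℝ → Al N, P = fun a => aeval (J N r) (P0 a) := ⟨_, rfl⟩
  have hPa : ∀ a, aeval (J N r) (P0 a) = P a := fun a => by rw [hP]
  simp only [hPa] at h0 h1 h2
  have Psa : ∀ a, st (P a) = P a := fun a => by rw [← hPa]; exact st_aeval (st_J N r) _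
  have Pmem : ∀ a, P a ∈ Su (Stb N (r + 1)) := by
    intro a
    have := (aeval (⟨J N r, J_mem N r⟩ : Su (Stb N (r + 1))) (P0 a)).2
    rw [← Subalgebra.val_apply, ← aeval_algHom_apply] at this
    rw [← hPa]; exact this
  have Pcomm : ∀ a, ∀ x ∈ Su (Stb N r), Commute (P a) x := fun a x hx => by rw [← hPa]; exact aeval_comm (J_comm hx) _
  have PJ : ∀ a, Commute (J N r) (P a) := fun a => by rw [← hPa]; exact (aeval_comm (Commute.refl _) _).symm
  have Porth := proj_orth h0 h1 h2 PJ
  have T := fun v hv a => tr_key hr h h0 h1 h2 (v := v) hv a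
  have hff : ∀ v ∈ Sh N r, ∀ w ∈ Sh N r, ∀ a b, (e v * P a) * (e w * P b) = if v = w ∧ a = b then e v * P a else 0 := by
    intro v hv w hw a b
    rw [mul_assoc, ← mul_assoc (P a), (Pcomm a _ (h.mem w hw)).eq, mul_assoc, ← mul_assoc, Porth, h.orth v hv w hw]
    by_cases h1 : v = w <;> by_cases h2 : a = b <;> simp [h1, h2]
  have fsa : ∀ v ∈ Sh N r, ∀ a, st (e v * P a) = e v * P a := by
    intro v hv a
    rw [st_mul, Psa, h.sa v hv, (Pcomm a _ (h.mem v hv)).eq]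
  have fz : ∀ v ∈ Sh N r, ∀ a, tr (e v * P a) = 0 → e v * P a = 0 := by
    intro v hv a ht
    apply tr_sq_zero (fsa v hv a)
    rw [hff v hv v hv]; simpa using ht
  have T1 : ∀ v ∈ Sh N r, ∀ i, tr (e v * P (yy v i)) = (r.factorial : ℝ) * DD v * DD (ad v i) := by
    intro v hv i
    rw [T v hv, sum_eq_single i]
    · simp
    · intro j _ hj
      rw [if_neg]; intro h; exact hj (yy_inj ((mem_Sh v).1 hv).1 h)
    · simp
  have T2 : ∀ v ∈ Sh N r, ∀ a, (∀ i, yy v i ≠ a) → e v * P a = 0 := by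
    intro v hv a ha
    apply fz v hv
    rw [T v hv, sum_eq_zero]
    intro i _; rw [if_neg (ha i)]
  have T3 : ∀ v ∈ Sh N r, ∀ i, ad v i ∉ Sh N (r + 1) → e v * P (yy v i) = 0 := by
    intro v hv i hi
    apply fz v hv
    rw [T1 v hv, DD_zero hv i hi, mul_zero]
  have T4 : ∀ v ∈ Sh N r, ∑ i, e v * P (yy v i) = e v := by
    intro v hv
    conv_rhs => rw [← mul_one (e v), ← h1, mul_sum]
    rw [← sum_image (s := univ) (g := yy v) (f := fun a => e v * P a) (yy_inj ((mem_Sh v).1 hv).1).injOn]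
    rw [sum_subset (subset_union_right (s₁ := S) (s₂ := univ.image (yy v))), 
      ← sum_subset (subset_union_left (s₁ := S) (s₂ := univ.image (yy v)))]
    · intro a _ ha
      have : P a = 0 := h0 a ha
      rw [this, mul_zero]
    · intro a _ ha
      apply T2 v hv
      rintro i rfl
      exact ha (by simp)
  set e' : (Fin N → ℕ) → Al N := fun L => ∑ v ∈ Sh N r, ∑ i, if ad v i = L then e v * P (yy v i) else 0 with he'
  have hfe : ∀ v ∈ Sh N r, ∀ i, ∀ M, e v * P (yy v i) * e' M = if ad v i = M then e v * P (yy v i) else 0 := by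
    intro v hv i M
    simp only [he']
    rw [mul_sum, sum_eq_single v]
    · rw [mul_sum, sum_eq_single i]
      · rw [mul_ite, mul_zero, hff v hv v hv]; simp
      · intro j _ hj
        rw [mul_ite, mul_zero, hff v hv v hv, if_neg (c := _ ∧ _)]
        · simp
        · rintro ⟨_, h⟩; exact hj (yy_inj ((mem_Sh v).1 hv).1 h).symm
      · simp
    · intro w hw hne
      rw [mul_sum]
      apply sum_eq_zero
      intro j _
      rw [mul_ite, mul_zero, hff v hv w hw, if_neg (c := _ ∧ _)]
      · simp
      · rintro ⟨h, _⟩; exact hne h.symm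
    · intro h; exact (h hv).elim
  refine ⟨e', ?_, ?_, ?_, ?_, ?_, ?_⟩
  · intro L _
    apply sum_mem; intro v hv
    apply sum_mem; intro i _
    split_ifs
    · exact mul_mem (Su_mono (Stb_mono (Nat.le_succ r)) (h.mem v hv)) (Pmem _)
    · exact zero_mem _
  · intro L _
    simp only [he', map_sum]
    apply sum_congr rfl; intro v hv
    apply sum_congr rfl; intro i _
    split_ifs
    · exact fsa v hv _
    · exact map_zero _
  · simp only [he']
    rw [sum_comm, ← h.sum]
    apply sum_congr rfl; intro v hv
    rw [sum_comm]
    refine Eq.trans ?_ (T4 v hv)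
    apply sum_congr rfl; intro i _
    rw [sum_ite_eq]
    split_ifs with hi
    · rfl
    · exact (T3 v hv i hi).symm
  · intro L _ M _
    have : e' L * e' M = ∑ v ∈ Sh N r, ∑ i, if ad v i = L then (if ad v i = M then e v * P (yy v i) else 0) else 0 := by
      conv_lhs => rw [he']
      simp only
      rw [sum_mul]
      apply sum_congr rfl; intro v hv
      rw [sum_mul]
      apply sum_congr rfl; intro i _
      rw [ite_mul, zero_mul]
      rw [← hfe v hv i M]
    rw [this]
    split_ifs with hLM
    · subst hLM
      simp only [he']
      apply sum_congr rfl; intro v hv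
      apply sum_congr rfl; intro i _
      split_ifs <;> rfl
    · apply sum_eq_zero; intro v hv
      apply sum_eq_zero; intro i _
      split_ifs with h1 h2
      · exact (hLM (h1.symm.trans h2)).elim
      · rfl
      · rfl
  · intro L hL
    have : tr (e' L) = ((r.factorial : ℝ) * DD L) * ∑ v ∈ Sh N r, ∑ i, (if ad v i = L then DD v else 0) := by
      simp only [he', map_sum, mul_sum]
      apply sum_congr rfl; intro v hv
      apply sum_congr rfl; intro i _
      split_ifs with hi
      · rw [T1 v hv, hi]; ring
      · simp
    rw [this, rem_sum hL, Nat.factorial_succ]; push_cast; ring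
  · intro L hL q
    simp only [he', mul_sum, smul_sum]
    apply sum_congr rfl; intro v hv
    apply sum_congr rfl; intro i _
    split_ifs with hi
    · have hJe : J N r * e v = e v * J N r := (J_comm (h.mem v hv)).eq
      have h2' : J N r * P (yy v i) = yy v i • P (yy v i) := h2 _
      rw [← hi, cp_ad, K, mul_assoc, ← mul_assoc (K N r q), h.eig v hv, smul_mul_assoc, mul_smul_comm, add_mul,
        ← Algebra.smul_def, ← mul_assoc, hJe, mul_assoc, h2', mul_smul_comm, ← add_smul, smul_smul]
    · simp

lemma inv_all {N r : ℕ} (hr : r ≤ N) : ∃ e, Inv N r e := by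
  induction r with
  | zero => exact ⟨_, inv_zero N⟩
  | succ r ih =>
    obtain ⟨e, he⟩ := ih (by omega)
    exact inv_succ hr he

end WC

end

section
open Finset Polynomial

namespace WC

lemma inv_central {N : ℕ} {e : (Fin N → ℕ) → Al N} (h : Inv N N e) {f : Fin N → ℕ} (hf : f ∈ Sh N N) (a : Al N) :
    Commute (e f) a := by
  apply h.comm le_rfl hf
  induction a using A_ind with
  | h1 g => exact dl_mem (by rw [Stb_top]; trivial)
  | h2 x y hx hy => exact add_mem hx hy
  | h3 c x hx => exact Subalgebra.smul_mem _ hx c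

lemma coeff_eq_tr {G : Type*} [Group G] [Fintype G] [DecidableEq G] (x : MonoidAlgebra ℝ G) (g : G) :
    x.coeff g = tr (x * dl g⁻¹) := by
  induction x using A_ind with
  | h1 h => rw [dl_mul, tr_dl, dl]; simp [Finsupp.single_apply, mul_inv_eq_one]
  | h2 x y hx hy => rw [add_mul, map_add, ← hx, ← hy]; simp
  | h3 c x hx => rw [smul_mul_assoc, map_smul, ← hx]; simp

lemma sum_dl {G : Type*} [Group G] [Fintype G] [DecidableEq G] (x : MonoidAlgebra ℝ G) :
    ∑ g, x.coeff g • dl g = x := by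
  induction x using A_ind with
  | h1 h => 
    rw [Finset.sum_eq_single h]
    · simp [dl]
    · intro b _ hb
      simp [dl, Finsupp.single_apply, hb.symm]
    · simp
  | h2 x y hx hy => 
    conv_rhs => rw [← hx, ← hy, ← sum_add_distrib]
    apply sum_congr rfl; intro g _; rw [← add_smul]; simp
  | h3 c x hx => 
    conv_rhs => rw [← hx, smul_sum]
    apply sum_congr rfl; intro g _; rw [smul_smul]; simp

lemma central_coeff {N : ℕ} {z : Al N} (hz : ∀ a, Commute z a) {g h : Equiv.Perm (Fin N)} (hgh : IsConj g h) :
    z.coeff g = z.coeff h := by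
  obtain ⟨c, rfl⟩ := isConj_iff.1 hgh
  rw [coeff_eq_tr, coeff_eq_tr, show (c * g * c⁻¹)⁻¹ = c * g⁻¹ * c⁻¹ by group, ← dl_mul, ← mul_assoc,
    tr_comm (z * dl (c * g⁻¹)), ← mul_assoc, ← (hz (dl c⁻¹)).eq, mul_assoc z, dl_mul,
    show c⁻¹ * (c * g⁻¹) = g⁻¹ by group]

noncomputable def cl (N : ℕ) : ((Fintype.card (Fin N)).Partition → ℝ) →ₗ[ℝ] Al N where
  toFun φ := ∑ g : Equiv.Perm (Fin N), φ g.partition • dl g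
  map_add' a b := by simp [add_smul, sum_add_distrib]
  map_smul' a b := by simp [smul_sum, smul_smul]

lemma central_range {N : ℕ} {z : Al N} (hz : ∀ a, Commute z a) : z ∈ LinearMap.range (cl N) := by
  classical
  refine ⟨fun p => if h : ∃ g : Equiv.Perm (Fin N), g.partition = p then z.coeff h.choose else 0, ?_⟩
  show ∑ g : Equiv.Perm (Fin N), _ • dl g = z
  conv_rhs => rw [← sum_dl z]
  apply sum_congr rfl
  intro g _
  have h : ∃ g' : Equiv.Perm (Fin N), g'.partition = g.partition := ⟨g, rfl⟩
  congr 1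
  refine (dif_pos h).trans ?_
  exact central_coeff hz (Equiv.Perm.partition_eq_of_isConj.2 h.choose_spec)

lemma w_pos {N : ℕ} {e : (Fin N → ℕ) → Al N} (h : Inv N N e) {f : Fin N → ℕ} (hf : f ∈ Sh N N) :
    0 < tr (e f) := by
  rw [h.trr f hf]
  have := DD_pos ((mem_Sh f).1 hf).1
  positivity

lemma lin {N : ℕ} {e : (Fin N → ℕ) → Al N} (h : Inv N N e) (c : (Fin N → ℕ) → ℝ) {f : Fin N → ℕ} (hf : f ∈ Sh N N) :
    (∑ g ∈ Sh N N, c g • e g) * e f = c f • e f := by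
  rw [sum_mul, sum_eq_single f]
  · rw [smul_mul_assoc, h.orth f hf f hf, if_pos rfl]
  · intro b hb hbf
    rw [smul_mul_assoc, h.orth b hb f hf, if_neg hbf, smul_zero]
  · intro h'; exact absurd hf h'

lemma card_Sh_le {N : ℕ} {e : (Fin N → ℕ) → Al N} (h : Inv N N e) :
    (Sh N N).card ≤ Fintype.card (N.Partition) ∧ 
    (Fintype.card (N.Partition) ≤ (Sh N N).card → ∀ z : Al N, (∀ a, Commute z a) →
      z = ∑ f ∈ Sh N N, (tr (z * e f) / tr (e f)) • e f) := by
  have hli : LinearIndependent ℝ (fun f : Sh N N => e f) := by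
    rw [Fintype.linearIndependent_iff]
    intro c hc f
    have h1 := lin h (fun g => if hg : g ∈ Sh N N then c ⟨g, hg⟩ else 0) f.2
    rw [← sum_coe_sort (Sh N N)] at h1
    simp only [coe_mem, dif_pos] at h1
    rw [hc, zero_mul] at h1
    have h2 := congrArg tr h1
    rw [map_zero, map_smul, smul_eq_mul] at h2
    exact (mul_eq_zero.1 h2.symm).resolve_right (w_pos h f.2).ne'
  have hle : Submodule.span ℝ (Set.range fun f : Sh N N => e f) ≤ LinearMap.range (cl N) := by
    rw [Submodule.span_le]
    rintro _ ⟨f, rfl⟩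
    exact central_range (inv_central h f.2)
  have hd := finrank_span_eq_card hli
  have hr : Module.finrank ℝ (LinearMap.range (cl N)) ≤ Fintype.card (N.Partition) := by
    refine (LinearMap.finrank_range_le _).trans ?_
    rw [Module.finrank_fintype_fun_eq_card]
    simp
  rw [Fintype.card_coe] at hd
  have hfin : FiniteDimensional ℝ (LinearMap.range (cl N)) := inferInstance
  have hl := Submodule.finrank_mono hle
  refine ⟨by omega, fun hc z hz => ?_⟩
  have heq := Submodule.eq_of_le_of_finrank_le hle (by omega)
  have hz' := central_range hz
  rw [← heq, Submodule.mem_span_range_iff_exists_fun] at hz'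
  obtain ⟨c, hc⟩ := hz'
  have : z = ∑ f ∈ Sh N N, (fun g => if hg : g ∈ Sh N N then c ⟨g, hg⟩ else 0) f • e f := by
    rw [← hc, ← sum_coe_sort (Sh N N)]
    simp
  rw [this]
  apply sum_congr rfl
  intro f hf
  rw [lin h _ hf, map_smul, smul_eq_mul, mul_div_cancel_right₀ _ (w_pos h hf).ne']

noncomputable def Ph {N : ℕ} (lam : N.Partition) : Fin N → ℕ := fun i => (lam.parts.sort (· ≥ ·)).getD i 0

lemma len_le {N : ℕ} (lam : N.Partition) : (lam.parts.sort (· ≥ ·)).length ≤ N := by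
  rw [Multiset.length_sort]
  have h := Multiset.card_nsmul_le_sum (s := lam.parts) (a := 1) (fun x hx => lam.parts_pos hx)
  rw [lam.parts_sum] at h
  simpa using h

lemma range_prod {M : Type*} [CommMonoid M] {N : ℕ} (lam : N.Partition) (F : ℕ → M)
    (hF : ∀ a, (lam.parts.sort (· ≥ ·)).getD a 0 = 0 → F a = 1) :
    ∏ a ∈ range (lam.parts.sort (· ≥ ·)).length, F a = ∏ a : Fin N, F a := by
  rw [← Finset.prod_range]
  apply prod_subset (by simpa using len_le lam)
  intro x _ hx
  apply hF
  simp at hx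
  simp [List.getD_eq_getElem?_getD, List.getElem?_eq_none_iff, hx]

lemma Ph_mem {N : ℕ} (lam : N.Partition) : Ph lam ∈ Sh N N := by
  rw [mem_Sh]
  constructor
  · intro i j hij
    simp only [Ph]
    by_cases hj : (j : ℕ) < (lam.parts.sort (· ≥ ·)).length
    · have hi : (i : ℕ) < (lam.parts.sort (· ≥ ·)).length := lt_of_le_of_lt hij hj
      rw [List.getD_eq_getElem _ _ hj, List.getD_eq_getElem _ _ hi]
      rcases eq_or_lt_of_le hij with rfl | hlt
      · exact le_rfl
      · exact List.pairwise_iff_getElem.1 (Multiset.pairwise_sort lam.parts (· ≥ ·)) i j hi hj hlt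
    · rw [List.getD_eq_default _ _ (not_lt.1 hj)]; exact Nat.zero_le _
  · have h := range_prod (M := Multiplicative ℕ) lam (fun a => Multiplicative.ofAdd ((lam.parts.sort (· ≥ ·)).getD a 0))
      (fun a ha => by rw [ha]; rfl)
    have h2 : ∑ a ∈ range (lam.parts.sort (· ≥ ·)).length, (lam.parts.sort (· ≥ ·)).getD a 0 = ∑ a, Ph lam a := h
    rw [← h2, Finset.sum_range]
    have h3 : (lam.parts.sort (· ≥ ·)).sum = N := by
      rw [← Multiset.sum_coe, Multiset.sort_eq, lam.parts_sum]
    conv_rhs => rw [← h3]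
    rw [← List.sum_ofFn]
    congr 1
    apply List.ext_getElem <;> simp

lemma Ph_inj {N : ℕ} : Function.Injective (Ph (N := N)) := by
  intro l m h
  have h1 : ∀ a, (l.parts.sort (· ≥ ·)).getD a 0 = (m.parts.sort (· ≥ ·)).getD a 0 := by
    intro a
    by_cases ha : a < N
    · exact congrFun h ⟨a, ha⟩
    · rw [List.getD_eq_default _ _ ((len_le l).trans (not_lt.1 ha)), List.getD_eq_default _ _ ((len_le m).trans (not_lt.1 ha))]
  have key : ∀ p : N.Partition, ∀ a, a < (p.parts.sort (· ≥ ·)).length ↔ (p.parts.sort (· ≥ ·)).getD a 0 ≠ 0 := by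
    intro p a
    constructor
    · intro ha
      rw [List.getD_eq_getElem _ _ ha]
      have : (p.parts.sort (· ≥ ·))[a] ∈ p.parts := by
        rw [← Multiset.mem_sort (r := (· ≥ ·))]; exact List.getElem_mem ha
      exact (p.parts_pos this).ne'
    · intro ha
      by_contra hh
      exact ha (List.getD_eq_default _ _ (not_lt.1 hh))
  have hlen : (l.parts.sort (· ≥ ·)).length = (m.parts.sort (· ≥ ·)).length := by
    apply le_antisymm <;> by_contra hh
    · have := (key l (m.parts.sort (· ≥ ·)).length).1 (by omega)
      rw [h1, ← key m] at this; omega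
    · have := (key m (l.parts.sort (· ≥ ·)).length).1 (by omega)
      rw [← h1, ← key l] at this; omega
  have hL : l.parts.sort (· ≥ ·) = m.parts.sort (· ≥ ·) := by
    apply List.ext_getElem hlen
    intro i hi hj
    have := h1 i
    rwa [List.getD_eq_getElem _ _ hi, List.getD_eq_getElem _ _ hj] at this
  apply Nat.Partition.ext
  rw [← Multiset.sort_eq l.parts (· ≥ ·), hL, Multiset.sort_eq]

lemma card_le_Sh {N : ℕ} : Fintype.card (N.Partition) ≤ (Sh N N).card := by
  classical
  rw [← Finset.card_univ, ← card_image_of_injective univ Ph_inj]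
  apply card_le_card
  intro f hf
  obtain ⟨l, _, rfl⟩ := mem_image.1 hf
  exact Ph_mem l

lemma sum_Sh {N : ℕ} {e : (Fin N → ℕ) → Al N} (h : Inv N N e) (F : (Fin N → ℕ) → ℝ) :
    ∑ f ∈ Sh N N, F f = ∑ l : N.Partition, F (Ph l) := by
  classical
  have : univ.image (Ph (N := N)) = Sh N N := by
    apply eq_of_subset_of_card_le
    · intro f hf
      obtain ⟨l, _, rfl⟩ := mem_image.1 hf
      exact Ph_mem l
    · rw [card_image_of_injective univ Ph_inj, card_univ]
      exact (card_Sh_le h).1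
  rw [← this, sum_image (fun a _ b _ hab => Ph_inj hab)]

end WC

end

section
open Finset Polynomial

namespace WC

lemma hook_eq {N : ℕ} (lam : N.Partition) : hookProd lam = hk (Ph lam) := by
  have hcj : ∀ b, ((Finset.range (lam.parts.sort (· ≥ ·)).length).filter fun a' => b < (lam.parts.sort (· ≥ ·)).getD a' 0).card
      = cj (Ph lam) b := by
    intro b
    have h := range_prod (M := Multiplicative ℕ) lam
      (fun a => Multiplicative.ofAdd (if b < (lam.parts.sort (· ≥ ·)).getD a 0 then 1 else 0))
      (fun a ha => by rw [ha]; simp)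
    rw [card_filter, cj, card_filter]
    exact h
  simp only [hookProd, hk, hcj]
  exact range_prod lam (fun a => ∏ b ∈ range ((lam.parts.sort (· ≥ ·)).getD a 0), 
    ((lam.parts.sort (· ≥ ·)).getD a 0 + cj (Ph lam) b - a - b - 1)) (fun a ha => by rw [ha]; simp)

lemma cont_eq {N : ℕ} (lam : N.Partition) (q : ℝ) : contentProd q lam = cp (Ph lam) q := by
  simp only [contentProd, cp]
  exact range_prod lam (fun a => ∏ b ∈ range ((lam.parts.sort (· ≥ ·)).getD a 0), (q + (b : ℝ) - (a : ℝ)))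
    (fun a ha => by rw [ha]; simp)

noncomputable def Om (N : ℕ) : Al N := ∑ b : Equiv.Perm (Fin N), ∑ a : Equiv.Perm (Fin N), dl (a * b * a⁻¹ * b⁻¹)

lemma Om_eq {N : ℕ} {e : (Fin N → ℕ) → Al N} (h : Inv N N e) :
    Om N = ∑ f ∈ Sh N N, ((N.factorial : ℝ) / tr (e f)) • e f := by
  have h1 : ∀ b : Equiv.Perm (Fin N), ∑ a : Equiv.Perm (Fin N), dl (a * b * a⁻¹) =
      ∑ f ∈ Sh N N, ((N.factorial : ℝ) * (e f).coeff b⁻¹ / tr (e f)) • e f := by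
    intro b
    have hz : ∀ x : Al N, Commute (∑ a : Equiv.Perm (Fin N), dl (a * b * a⁻¹)) x := by
      intro x
      induction x using A_ind with
      | h1 g => 
        show _ * _ = _ * _
        rw [sum_mul, mul_sum]
        apply Fintype.sum_equiv (Equiv.mulLeft g⁻¹)
        intro a
        rw [dl_mul, dl_mul]
        congr 1
        simp [mul_assoc]
      | h2 x y hx hy => exact hx.add_right hy
      | h3 c x hx => exact hx.smul_right c
    rw [(card_Sh_le h).2 card_le_Sh _ hz]
    apply sum_congr rfl
    intro f hf
    congr 2
    rw [sum_mul, map_sum]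
    have : ∀ a : Equiv.Perm (Fin N), tr (dl (a * b * a⁻¹) * e f) = (e f).coeff b⁻¹ := by
      intro a
      rw [coeff_eq_tr, inv_inv, ← dl_mul, mul_assoc, tr_comm, mul_assoc, ← mul_assoc (dl a⁻¹) (e f)]
      rw [← (inv_central h hf _).eq, mul_assoc, dl_mul, inv_mul_cancel_left]
    rw [sum_congr rfl fun a _ => this a, sum_const, card_univ, Fintype.card_perm, Fintype.card_fin, nsmul_eq_mul]
  have h2 : Om N = ∑ b : Equiv.Perm (Fin N), (∑ a : Equiv.Perm (Fin N), dl (a * b * a⁻¹)) * dl b⁻¹ := by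
    rw [Om]
    apply sum_congr rfl
    intro b _
    rw [sum_mul]
    apply sum_congr rfl
    intro a _
    rw [dl_mul]
  rw [h2]
  simp only [h1, sum_mul]
  rw [sum_comm]
  apply sum_congr rfl
  intro f hf
  have h3 : ∑ b : Equiv.Perm (Fin N), (e f).coeff b⁻¹ • dl b⁻¹ = e f := by
    conv_rhs => rw [← sum_dl (e f)]
    exact Fintype.sum_equiv (Equiv.inv _) _ _ (fun b => rfl)
  have h4 : e f = e f * e f := by rw [h.orth f hf f hf, if_pos rfl]
  have h5 : ((N.factorial : ℝ) / tr (e f)) • e f =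
      e f * (((N.factorial : ℝ) / tr (e f)) • ∑ b : Equiv.Perm (Fin N), (e f).coeff b⁻¹ • dl b⁻¹) := by
    rw [h3, mul_smul_comm, ← h4]
  rw [h5, smul_sum, mul_sum]
  apply sum_congr rfl
  intro b _
  rw [smul_smul, mul_smul_comm, smul_mul_assoc]
  congr 1
  ring

noncomputable def Wk (N k : ℕ) : Al N := ∑ v : Fin k → Equiv.Perm (Fin N), dl (wc v)

lemma Wk_zero (N : ℕ) : Wk N 0 = 1 := by
  simp [Wk, wc, dl_one]

lemma sum_cons {G M : Type*} [Fintype G] [AddCommMonoid M] (k : ℕ) (F : (Fin (k + 1) → G) → M) :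
    ∑ v, F v = ∑ u : Fin k → G, ∑ a : G, F (Fin.cons a u) := by
  rw [← (Fin.consEquiv fun _ => G).sum_comp, Fintype.sum_prod_type, sum_comm]
  rfl

lemma Wk_succ (N k : ℕ) : Wk N (k + 2) = Om N * Wk N k := by
  rw [Wk, sum_cons, sum_cons, Wk, mul_sum]
  apply sum_congr rfl
  intro u _
  rw [Om, sum_mul]
  simp only [sum_mul, dl_mul]
  apply Fintype.sum_equiv (Equiv.mulLeft (List.ofFn u).prod)
  intro b
  apply Fintype.sum_equiv (Equiv.mulRight (List.ofFn u).prod⁻¹)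
  intro a
  congr 1
  simp [wc, List.ofFn_succ]
  group

lemma Wk_eq {N : ℕ} {e : (Fin N → ℕ) → Al N} (h : Inv N N e) (m : ℕ) :
    Wk N (2 * m) = ∑ f ∈ Sh N N, ((N.factorial : ℝ) / tr (e f)) ^ m • e f := by
  induction m with
  | zero => simp [Wk_zero, h.sum]
  | succ m ih =>
    rw [show 2 * (m + 1) = 2 * m + 2 by ring, Wk_succ, ih, Om_eq h, mul_sum]
    apply sum_congr rfl
    intro f hf
    rw [mul_smul_comm, lin h _ hf, smul_smul, pow_succ]

lemma nc_inv {N : ℕ} (g : Equiv.Perm (Fin N)) : nc g⁻¹ = nc g := by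
  rw [nc, nc, Equiv.Perm.cycleType_inv]
  congr 2
  ext i
  simp only [mem_filter, mem_univ, true_and]
  rw [Equiv.Perm.inv_eq_iff_eq, eq_comm]

lemma tr_K {N : ℕ} (q : ℝ) (g : Equiv.Perm (Fin N)) : tr (K N N q * dl g) = q ^ nc g := by
  classical
  rw [K_sum le_rfl, sum_mul, map_sum, sum_eq_single g⁻¹]
  · rw [smul_mul_assoc, map_smul, dl_mul, tr_dl, ec_top, nc_inv]; simp
  · intro b _ hb
    rw [smul_mul_assoc, map_smul, dl_mul, tr_dl, if_neg, smul_zero]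
    intro h'; exact hb (eq_inv_of_mul_eq_one_left h')
  · intro h'
    exfalso; apply h'; rw [mem_filter, Stb_top]; exact ⟨mem_univ _, trivial⟩

end WC

end


/-- Generating function for the number of cycles of `w_c(σ_1,…,σ_k)` (even `k`):
`Σ q^{C(w_c)} = n! Σ_{λ ⊢ n} H_λ^{k-2} Π_{r ∈ λ} (q + cont(r))`. -/
theorem wc_cycle_generating_function_even (k : ℕ) (hk : 2 ≤ k) (hke : Even k)
    (n : ℕ) (hn : 1 ≤ n) (q : ℝ) :
    ∑ v : Fin k → Equiv.Perm (Fin n), q ^ numCycles (wc v)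
      = (n.factorial : ℝ) * ∑ lam : Nat.Partition n,
          (hookProd lam : ℝ) ^ (k - 2) * contentProd q lam := by
  obtain ⟨e, h⟩ := WC.inv_all (N := n) le_rfl
  obtain ⟨m, rfl⟩ := hke.exists_two_nsmul
  obtain ⟨j, rfl⟩ : ∃ j, m = j + 1 := ⟨m - 1, by simp at hk; omega⟩
  rw [smul_eq_mul] at *
  have h1 : ∑ v : Fin (2 * (j + 1)) → Equiv.Perm (Fin n), q ^ numCycles (wc v) =
      WC.tr (WC.K n n q * WC.Wk n (2 * (j + 1))) := by
    rw [WC.Wk, Finset.mul_sum, map_sum]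
    exact Finset.sum_congr rfl fun v _ => (WC.tr_K q _).symm
  rw [h1, WC.Wk_eq h, Finset.mul_sum, map_sum]
  have h2 : ∀ f ∈ WC.Sh n n, WC.tr (WC.K n n q * (((n.factorial : ℝ) / WC.tr (e f)) ^ (j + 1) • e f)) =
      (n.factorial : ℝ) * ((WC.hk f : ℝ) ^ (2 * j) * WC.cp f q) := by
    intro f hf
    rw [mul_smul_comm, h.eig f hf, map_smul, map_smul, smul_eq_mul, smul_eq_mul]
    have hd := WC.DD_hk ((WC.mem_Sh f).1 hf).1
    have hp := WC.DD_pos ((WC.mem_Sh f).1 hf).1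
    have hw := WC.w_pos h hf
    have hn0 : (n.factorial : ℝ) ≠ 0 := by positivity
    have h3 : (n.factorial : ℝ) / WC.tr (e f) = (WC.hk f : ℝ) ^ 2 := by
      rw [h.trr f hf, div_eq_iff (by positivity)]
      linear_combination (-(n.factorial : ℝ)) * (WC.DD f * WC.hk f + 1) * hd
    have h4 : (WC.hk f : ℝ) ^ 2 * WC.tr (e f) = n.factorial := by
      rw [← h3, div_mul_cancel₀ _ hw.ne']
    rw [h3, pow_succ, pow_mul, ← h4]
    ring
  rw [Finset.sum_congr rfl h2, ← Finset.mul_sum, WC.sum_Sh h]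
  congr 1
  apply Finset.sum_congr rfl
  intro l _
  rw [WC.hook_eq, WC.cont_eq, show 2 * (j + 1) - 2 = 2 * j by omega]
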